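/- arXiv:2109.02758 — 5 statements merged into one kernel-verified Lean document; each statement's English description precedes it below -/
import Mathlib

section
/- Let G = ℤ ⊕ ℤ, written multiplicatively with commuting generators t₁ and t₂, and let M be a G-module. Then the second group cohomology H²(G, M) is isomorphic, as an abelian group, to the cokernel of the homomorphism f₂* : M ⊕ M → M defined by f₂*(m₁, m₂) = (t₂·m₁ − m₁) − (t₁·m₂ − m₂). -/
theorem aux_exists_geom {R : Type*} [CommRing R] (u : Rˣ) :
    ∃ P : ℤ → R, P 1 = 1 ∧ ∀ a b, P (a + b) = P a + ((u ^ a : Rˣ) : R) * P b := by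
  let σ : Equiv.Perm R := u.mulLeft.trans (Equiv.addRight 1)
  have hσ : ∀ x, σ x = u * x + 1 := fun x => rfl
  have hσ' : ∀ x, σ⁻¹ x = (u⁻¹ : Rˣ) * (x - 1) := fun x => by
    rw [Equiv.Perm.inv_eq_iff_eq, hσ]; simp
  have key : ∀ a : ℤ, ∀ x, (σ ^ a) x = ((u ^ a : Rˣ) : R) * x + (σ ^ a) 0 := by
    intro a
    induction a using Int.induction_on with
    | zero => simp
    | succ n ih =>
      intro x
      rw [zpow_add_one, zpow_add_one, Equiv.Perm.mul_apply, Equiv.Perm.mul_apply, ih (σ x), ih (σ 0), hσ, hσ]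
      push_cast; ring
    | pred n ih =>
      intro x
      rw [zpow_sub_one, zpow_sub_one, Equiv.Perm.mul_apply, Equiv.Perm.mul_apply, ih (σ⁻¹ x), ih (σ⁻¹ 0), hσ', hσ']
      push_cast; ring
  refine ⟨fun a => (σ ^ a) 0, by simp [hσ], fun a b => ?_⟩
  simp only [zpow_add, Equiv.Perm.mul_apply]
  rw [key a ((σ ^ b) 0), add_comm]

/-- The underlying set of the group extension attached to a 2-cocycle. -/
structure AuxExt (M : Type) where
  fst : M
  snd : Multiplicative (ℤ × ℤ)

theorem aux_section {E : Type*} [Group E] (π : E →* Multiplicative (ℤ × ℤ)) (e₁ e₂ : E)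
    (h₁ : π e₁ = Multiplicative.ofAdd ((1, 0) : ℤ × ℤ))
    (h₂ : π e₂ = Multiplicative.ofAdd ((0, 1) : ℤ × ℤ)) (h : Commute e₁ e₂) :
    ∃ s : Multiplicative (ℤ × ℤ) →* E, ∀ g, π (s g) = g := by
  refine ⟨MonoidHom.mk' (fun g => e₁ ^ (g.toAdd.1) * e₂ ^ (g.toAdd.2)) ?_, ?_⟩
  · intro a b
    simp only [toAdd_mul, Prod.fst_add, Prod.snd_add, zpow_add]
    have := (h.zpow_zpow b.toAdd.1 a.toAdd.2).eq
    simp only [mul_assoc]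
    rw [← mul_assoc (e₂ ^ _) (e₁ ^ _), ← this]
    simp only [mul_assoc]
  · intro g
    simp only [MonoidHom.mk'_apply, map_mul, map_zpow, h₁, h₂]
    apply Multiplicative.toAdd.injective
    ext <;> simp

theorem aux_inj {M : Type} [AddCommGroup M] [Module ℤ M]
    (ρ : Representation ℤ (Multiplicative (ℤ × ℤ)) M)
    (t₁ t₂ : Multiplicative (ℤ × ℤ))
    (ht₁ : t₁ = Multiplicative.ofAdd ((1, 0) : ℤ × ℤ))
    (ht₂ : t₂ = Multiplicative.ofAdd ((0, 1) : ℤ × ℤ))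
    (c : Multiplicative (ℤ × ℤ) × Multiplicative (ℤ × ℤ) → M)
    (hc : ∀ g h j, c (g * h, j) + c (g, h) = ρ g (c (h, j)) + c (g, h * j))
    (h12 : c (t₁, t₂) = c (t₂, t₁)) :
    ∃ x : Multiplicative (ℤ × ℤ) → M, ∀ g h, ρ g (x h) - x (g * h) + x g = c (g, h) := by
  have hc1 : ∀ g, c (1, g) = c (1, 1) := fun g => by
    have := hc 1 1 g
    simp at this; exact this.symm
  let mulI : Mul (AuxExt M) := ⟨fun p q => ⟨p.1 + ρ p.2 q.1 + c (p.2, q.2), p.2 * q.2⟩⟩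
  let oneI : One (AuxExt M) := ⟨⟨- c (1, 1), 1⟩⟩
  let invI : Inv (AuxExt M) :=
    ⟨fun p => ⟨- ρ p.2⁻¹ p.1 - c (p.2⁻¹, p.2) - c (1, 1), p.2⁻¹⟩⟩
  have mul_def : ∀ p q : AuxExt M,
    p * q = ⟨p.1 + ρ p.2 q.1 + c (p.2, q.2), p.2 * q.2⟩ := fun _ _ => rfl
  let grp : Group (AuxExt M) := Group.ofLeftAxioms
    (fun p q r => by
      rw [mul_def, mul_def, mul_def, mul_def]
      have := hc p.2 q.2 r.2
      rw [AuxExt.mk.injEq]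
      constructor
      · simp only [map_add, map_mul, Module.End.mul_apply]
        have h2 := eq_sub_of_add_eq this
        rw [h2]; abel
      · exact mul_assoc _ _ _)
    (fun p => by
      rw [mul_def]
      change (⟨- c (1, 1) + ρ 1 p.1 + c (1, p.2), 1 * p.2⟩ : AuxExt M) = p
      rw [hc1 p.2]; simp)
    (fun p => by
      rw [mul_def]
      change (⟨(- ρ p.2⁻¹ p.1 - c (p.2⁻¹, p.2) - c (1, 1)) + ρ p.2⁻¹ p.1 + c (p.2⁻¹, p.2),
        p.2⁻¹ * p.2⟩ : AuxExt M) = ⟨- c (1, 1), 1⟩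
      rw [AuxExt.mk.injEq]
      constructor
      · abel
      · simp)
  have mul_def' : ∀ p q : AuxExt M,
    p * q = ⟨p.1 + ρ p.2 q.1 + c (p.2, q.2), p.2 * q.2⟩ := fun _ _ => rfl
  obtain ⟨s, hs2⟩ := aux_section (E := AuxExt M) (MonoidHom.mk' AuxExt.snd (fun _ _ => rfl))
    ⟨0, t₁⟩ ⟨0, t₂⟩ ht₁ ht₂ (by
      change _ * _ = _ * _
      rw [mul_def', mul_def']
      simp [h12, mul_comm])
  replace hs2 : ∀ g, (s g).snd = g := hs2
  refine ⟨fun g => - (s g).1, fun g h => ?_⟩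
  have := congrArg AuxExt.fst (map_mul s g h)
  rw [mul_def', hs2, hs2] at this
  simp only [this, map_neg]
  abel

theorem aux_ring {R : Type*} [CommRing R] (u v : Rˣ) (P Q : ℤ → R)
    (hP : ∀ a b, P (a + b) = P a + ((u ^ a : Rˣ) : R) * P b)
    (hQ : ∀ a b, Q (a + b) = Q a + ((v ^ a : Rˣ) : R) * Q b) (a b a' b' a'' : ℤ) :
    ((u ^ (a + a') : Rˣ) : R) * Q (b + b') * P a'' + ((u ^ a : Rˣ) : R) * Q b * P a' =
      ((u ^ a * v ^ b : Rˣ) : R) * (((u ^ a' : Rˣ) : R) * Q b' * P a'') +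
        ((u ^ a : Rˣ) : R) * Q b * P (a' + a'') := by
  rw [hP, hQ, zpow_add, Units.val_mul, Units.val_mul]
  ring

theorem aux_surj {M : Type} [AddCommGroup M] [Module ℤ M]
    (ρ : Representation ℤ (Multiplicative (ℤ × ℤ)) M)
    (t₁ t₂ : Multiplicative (ℤ × ℤ))
    (ht₁ : t₁ = Multiplicative.ofAdd ((1, 0) : ℤ × ℤ))
    (ht₂ : t₂ = Multiplicative.ofAdd ((0, 1) : ℤ × ℤ)) (m : M) :
    ∃ c : Multiplicative (ℤ × ℤ) × Multiplicative (ℤ × ℤ) → M,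
      (∀ g h j, c (g * h, j) + c (g, h) = ρ g (c (h, j)) + c (g, h * j)) ∧
      c (t₁, t₂) - c (t₂, t₁) = m := by
  let ι : Multiplicative (ℤ × ℤ) →* (MonoidAlgebra ℤ (Multiplicative (ℤ × ℤ)))ˣ := (MonoidAlgebra.of ℤ (Multiplicative (ℤ × ℤ))).toHomUnits
  have hι : ∀ g, ((ι g : (MonoidAlgebra ℤ (Multiplicative (ℤ × ℤ)))ˣ) : MonoidAlgebra ℤ (Multiplicative (ℤ × ℤ))) = MonoidAlgebra.of ℤ (Multiplicative (ℤ × ℤ)) g :=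
    fun g => rfl
  have hdec : ∀ g : Multiplicative (ℤ × ℤ), ι g = ι t₁ ^ g.toAdd.1 * ι t₂ ^ g.toAdd.2 := by
    intro g
    rw [← map_zpow, ← map_zpow, ← map_mul]
    congr 1
    apply Multiplicative.toAdd.injective
    ext <;> simp [ht₁, ht₂]
  obtain ⟨P, hP1, hP⟩ := aux_exists_geom (ι t₁)
  obtain ⟨Q, hQ1, hQ⟩ := aux_exists_geom (ι t₂)
  have hQ0 : Q 0 = 0 := by simpa using hQ 0 0
  refine ⟨fun p => - ρ.asAlgebraHom (((ι t₁ ^ p.1.toAdd.1 : (MonoidAlgebra ℤ (Multiplicative (ℤ × ℤ)))ˣ) :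
    MonoidAlgebra ℤ (Multiplicative (ℤ × ℤ))) * Q p.1.toAdd.2 * P p.2.toAdd.1) m, ?_, ?_⟩
  · intro g h j
    have hg : ρ g = ρ.asAlgebraHom ((ι g : (MonoidAlgebra ℤ (Multiplicative (ℤ × ℤ)))ˣ) : MonoidAlgebra ℤ (Multiplicative (ℤ × ℤ))) := by
      rw [hι, Representation.asAlgebraHom_of]
    rw [hg, hdec g]
    have key := congrArg (fun r => - ρ.asAlgebraHom r m) (aux_ring (ι t₁) (ι t₂) P Q hP hQ
      g.toAdd.1 g.toAdd.2 h.toAdd.1 h.toAdd.2 j.toAdd.1)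
    simp only [map_add, map_mul ρ.asAlgebraHom, LinearMap.add_apply, Module.End.mul_apply,
      neg_add] at key
    simp only [map_neg, map_mul ρ.asAlgebraHom, Module.End.mul_apply, toAdd_mul, Prod.fst_add,
      Prod.snd_add]
    exact key
  · simp [ht₁, ht₂, hQ0, hQ1, hP1]

theorem aux_inj' {M : Type} [AddCommGroup M] [Module ℤ M]
    (ρ : Representation ℤ (Multiplicative (ℤ × ℤ)) M)
    (t₁ t₂ : Multiplicative (ℤ × ℤ))
    (ht₁ : t₁ = Multiplicative.ofAdd ((1, 0) : ℤ × ℤ))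
    (ht₂ : t₂ = Multiplicative.ofAdd ((0, 1) : ℤ × ℤ))
    (c : Multiplicative (ℤ × ℤ) × Multiplicative (ℤ × ℤ) → M)
    (hc : ∀ g h j, c (g * h, j) + c (g, h) = ρ g (c (h, j)) + c (g, h * j))
    (m₁ m₂ : M) (h : (ρ t₂ m₁ - m₁) - (ρ t₁ m₂ - m₂) = c (t₁, t₂) - c (t₂, t₁)) :
    ∃ x : Multiplicative (ℤ × ℤ) → M, ∀ g h, ρ g (x h) - x (g * h) + x g = c (g, h) := by
  have hne : t₁ ≠ t₂ := by
    rw [ht₁, ht₂]; intro h; simpa using congrArg (fun z => (Multiplicative.toAdd z).1) h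
  obtain ⟨x, hx1, hx2⟩ : ∃ x : Multiplicative (ℤ × ℤ) → M, x t₁ = -m₁ ∧ x t₂ = -m₂ :=
    ⟨fun g => if g = t₁ then -m₁ else -m₂, by simp, by simp [hne.symm]⟩
  obtain ⟨y, hy⟩ := aux_inj ρ t₁ t₂ ht₁ ht₂
    (fun p => c p - (ρ p.1 (x p.2) - x (p.1 * p.2) + x p.1))
    (fun g h j => by
      have := eq_sub_of_add_eq (hc g h j)
      simp only [map_sub, map_add, map_mul, Module.End.mul_apply, this, mul_assoc]
      abel)
    (by
      simp only [hx1, hx2, mul_comm t₂ t₁]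
      rw [← sub_eq_zero]
      rw [← sub_eq_zero] at h
      rw [← neg_eq_zero, ← h]
      simp only [map_neg]
      abel)
  refine ⟨x + y, fun g k => ?_⟩
  have := hy g k
  simp only [Pi.add_apply, map_add]
  rw [← sub_eq_zero]
  rw [← sub_eq_zero] at this
  rw [← this]
  abel

open groupCohomology in
/-- Let `G = ℤ ⊕ ℤ` (written multiplicatively with commuting generators
`t₁`, `t₂`) and let `M` be a `G`-module.  Then `H²(G, M)` is isomorphic, as an abelian
group, to the cokernel of `f₂* : M ⊕ M → M`, `(m₁, m₂) ↦ (t₂·m₁ − m₁) − (t₁·m₂ − m₂)`. -/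
theorem groupCohomology_two_of_free_rank_two
    (M : Type) [AddCommGroup M] [Module ℤ M]
    (ρ : Representation ℤ (Multiplicative (ℤ × ℤ)) M)
    (t₁ t₂ : Multiplicative (ℤ × ℤ))
    (ht₁ : t₁ = Multiplicative.ofAdd ((1, 0) : ℤ × ℤ))
    (ht₂ : t₂ = Multiplicative.ofAdd ((0, 1) : ℤ × ℤ)) :
    Nonempty ((groupCohomology (Rep.of ρ) 2) ≃+
      M ⧸ AddSubgroup.closure
        (Set.range fun m : M × M => (ρ t₂ m.1 - m.1) - (ρ t₁ m.2 - m.2))) := by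
  set B := AddSubgroup.closure
        (Set.range fun m : M × M => (ρ t₂ m.1 - m.1) - (ρ t₁ m.2 - m.2)) with hB
  have memB : ∀ y, y ∈ B ↔ ∃ m₁ m₂ : M, (ρ t₂ m₁ - m₁) - (ρ t₁ m₂ - m₂) = y := by
    intro y
    constructor
    · intro hy
      induction hy using AddSubgroup.closure_induction with
      | mem x hx => obtain ⟨m, rfl⟩ := hx; exact ⟨m.1, m.2, rfl⟩
      | zero => exact ⟨0, 0, by simp⟩
      | add x y _ _ hx hy =>
        obtain ⟨a, b, rfl⟩ := hx
        obtain ⟨c, d, rfl⟩ := hy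
        exact ⟨a + c, b + d, by simp only [map_add]; abel⟩
      | neg x _ hx =>
        obtain ⟨a, b, rfl⟩ := hx
        exact ⟨-a, -b, by simp only [map_neg]; abel⟩
    · rintro ⟨a, b, rfl⟩
      exact AddSubgroup.subset_closure ⟨(a, b), rfl⟩
  let ψ : cocycles₂ (Rep.of ρ) →+ groupCohomology (Rep.of ρ) 2 :=
    (H2π (Rep.of ρ)).hom.toAddMonoidHom
  have hψ : Function.Surjective ψ := fun x => by
    induction x using H2_induction_on with
    | h x => exact ⟨x, rfl⟩
  have hψ0 : ∀ x, ψ x = 0 ↔ x.1 ∈ coboundaries₂ (Rep.of ρ) := fun x => H2π_eq_zero_iff x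
  let φ : cocycles₂ (Rep.of ρ) →+ M ⧸ B :=
    (QuotientAddGroup.mk' B).comp
      (AddMonoidHom.mk' (fun c => (c.1 (t₁, t₂) - c.1 (t₂, t₁) : M)) (fun a b => by
        change (a.1 (t₁, t₂) + b.1 (t₁, t₂) - (a.1 (t₂, t₁) + b.1 (t₂, t₁)) : M) = _
        abel))
  have hφ : Function.Surjective φ := fun y => by
    obtain ⟨m, rfl⟩ := QuotientAddGroup.mk_surjective y
    obtain ⟨c, hc, hm⟩ := aux_surj ρ t₁ t₂ ht₁ ht₂ m
    exact ⟨⟨c, (mem_cocycles₂_iff (A := Rep.of ρ) c).2 hc⟩, congrArg _ hm⟩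
  have hφ0 : ∀ x, φ x = 0 ↔ x.1 ∈ coboundaries₂ (Rep.of ρ) := by
    intro c
    have h0 : φ c = 0 ↔ (c.1 (t₁, t₂) - c.1 (t₂, t₁) : M) ∈ B := QuotientAddGroup.eq_zero_iff _
    have hcc := (mem_cocycles₂_iff (A := Rep.of ρ) c.1).1 c.2
    rw [h0, memB]
    constructor
    · rintro ⟨m₁, m₂, h⟩
      obtain ⟨x, hx⟩ := aux_inj' ρ t₁ t₂ ht₁ ht₂ c.1 hcc m₁ m₂ h
      exact ⟨x, funext fun p => hx p.1 p.2⟩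
    · rintro ⟨x, hx⟩
      refine ⟨-(x t₁ : M), -(x t₂ : M), ?_⟩
      rw [← hx]
      change _ = (ρ t₁ (x t₂) - x (t₁ * t₂) + x t₁) - (ρ t₂ (x t₁) - x (t₂ * t₁) + x t₂)
      rw [mul_comm t₂ t₁]
      simp only [map_neg]
      abel
  have hker : ψ.ker = φ.ker := by
    ext x
    rw [AddMonoidHom.mem_ker, AddMonoidHom.mem_ker, hψ0, hφ0]
  exact ⟨((QuotientAddGroup.quotientKerEquivOfSurjective ψ hψ).symm.trans
    (QuotientAddGroup.quotientAddEquivOfEq hker)).trans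
    (QuotientAddGroup.quotientKerEquivOfSurjective φ hφ)⟩
end

section
/- Let A be an integral domain and n ≥ 1, and let B = A[X_{ij}, 1/det]. Then the map A^× × ℤ → B^×, (a, k) ↦ a · det^k, is a bijection: every unit of B can be written uniquely in the form a · det^k with a ∈ A^× and k ∈ ℤ. -/
open MvPolynomial in
lemma det_mem_subalgebra' {K R : Type*} [CommRing K] [CommRing R] [Algebra K R]
    (S : Subalgebra K R) {n : ℕ} (M : Matrix (Fin n) (Fin n) R) (h : ∀ i j, M i j ∈ S) :
    M.det ∈ S := by
  rw [Matrix.det_apply']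
  exact sum_mem fun σ _ => mul_mem (intCast_mem S _) (prod_mem fun i _ => h _ _)

open MvPolynomial in
lemma eval_det_X' {K σ : Type*} [CommRing K] {n : ℕ} (f : Fin n × Fin n → σ) (s : σ → K) :
    eval s (Matrix.det (Matrix.of fun i j : Fin n => (X (f (i, j)) : MvPolynomial σ K))) =
      Matrix.det (Matrix.of fun i j => s (f (i, j))) := by
  rw [RingHom.map_det]
  congr 1
  ext i j
  simp

open MvPolynomial in
lemma irreducible_det_X' {K σ : Type*} [Field K] (n : ℕ) :
    ∀ (f : Fin (n + 1) × Fin (n + 1) → σ), Function.Injective f →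
    Irreducible (Matrix.det (Matrix.of fun i j : Fin (n + 1) =>
      (X (f (i, j)) : MvPolynomial σ K))) := by
  induction n with
  | zero =>
    intro f hf
    simp only [Nat.reduceAdd, Matrix.det_unique, Matrix.of_apply]
    exact (MvPolynomial.X_prime).irreducible
  | succ n ih =>
    intro f hf
    set M : Matrix (Fin (n + 2)) (Fin (n + 2)) (MvPolynomial σ K) :=
      Matrix.of fun i j => X (f (i, j)) with hM
    set m := Matrix.det (Matrix.of fun i j : Fin (n + 1) =>
      (X (f (i.succ, j.succ)) : MvPolynomial σ K)) with hm
    have hirr : Irreducible m := ih (fun p => f (p.1.succ, p.2.succ)) (by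
      rintro ⟨a, b⟩ ⟨c, e⟩ h
      have := hf h
      simpa using this)
    set g := ∑ j : Fin (n + 1), (-1) ^ ((j.succ : Fin (n + 2)) : ℕ) * M 0 j.succ *
      Matrix.det (M.submatrix Fin.succ j.succ.succAbove) with hg
    have hdet : M.det = m * X (f (0, 0)) + g := by
      rw [Matrix.det_succ_row_zero, Fin.sum_univ_succ, hg]
      congr 1
      simp only [Fin.val_zero, pow_zero, one_mul, Fin.succAbove_zero]
      rw [mul_comm]
      rfl
    have key : ∀ p ∈ supported K {x | x ≠ f (0, 0)}, f (0, 0) ∉ p.vars := by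
      intro p hp h
      exact (mem_supported.1 hp h) rfl
    have hX : ∀ i j, (i, j) ≠ (0, 0) → M i j ∈ supported K {x | x ≠ f (0, 0)} := by
      intro i j h
      refine Algebra.subset_adjoin ⟨f (i, j), fun h' => h (hf h'), rfl⟩
    rw [hdet]
    refine irreducible_mul_X_add m g _ hirr.ne_zero (key _ ?_) (key _ ?_) ?_
    · exact det_mem_subalgebra' _ _ fun i j => hX i.succ j.succ (by simp)
    · refine sum_mem fun j _ => mul_mem (mul_mem (pow_mem (neg_mem (one_mem _)) _) ?_) ?_
      · exact hX _ _ (by simp)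
      · exact det_mem_subalgebra' _ _ fun i k => hX i.succ _ (by simp)
    · rw [hirr.isRelPrime_iff_not_dvd]
      intro hdvd
      have hd : m ∣ M.det := hdet ▸ dvd_add (dvd_mul_right _ _) hdvd
      let P : Matrix (Fin (n + 2)) (Fin (n + 2)) K := (Equiv.swap 0 1).permMatrix K
      let s : σ → K := Function.extend f (fun p => P p.1 p.2) 0
      have hs : ∀ i j, s (f (i, j)) = P i j := fun i j => hf.extend_apply _ _ _
      have h1 : eval s M.det = P.det := by
        rw [hM, eval_det_X']
        congr 1
        ext i j
        simp [hs]
      have h2 : eval s m = 0 := by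
        rw [hm, eval_det_X' (fun p : Fin (n + 1) × Fin (n + 1) => f (p.1.succ, p.2.succ))]
        refine Matrix.det_eq_zero_of_row_eq_zero 0 fun j => ?_
        simp only [Matrix.of_apply, hs, P]
        simp [PEquiv.toMatrix_apply, Equiv.toPEquiv_apply]
        try exact (Fin.succ_ne_zero _).symm
      have h3 := map_dvd (eval s) hd
      rw [h1, h2, zero_dvd_iff, Matrix.det_permutation] at h3
      rcases Int.units_eq_one_or (Equiv.Perm.sign (Equiv.swap (0 : Fin (n + 2)) 1)) with h | h <;>
        simp [h] at h3

open MvPolynomial in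
lemma factor_det_pow' (A : Type) [CommRing A] [IsDomain A] (n : ℕ)
    (d : MvPolynomial (Fin (n + 1) × Fin (n + 1)) A)
    (hd : d = Matrix.det (Matrix.of fun i j : Fin (n + 1) => MvPolynomial.X (i, j))) :
    ¬ IsUnit d ∧ ∀ (p q : MvPolynomial (Fin (n + 1) × Fin (n + 1)) A) (m : ℕ), p * q = d ^ m →
      ∃ (a : A) (k : ℕ), p = C a * d ^ k := by
  let K := FractionRing A
  let φ := MvPolynomial.map (σ := Fin (n + 1) × Fin (n + 1)) (algebraMap A K)
  have hφ : Function.Injective φ := map_injective _ (IsFractionRing.injective A K)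
  have hirr : Irreducible (φ d) := by
    have := irreducible_det_X' (K := K) n (id : Fin (n + 1) × Fin (n + 1) → _)
      Function.injective_id
    convert this
    rw [hd, RingHom.map_det]
    congr 1
    ext1 i j
    simp [φ]
  refine ⟨fun h => hirr.not_isUnit (h.map φ), fun p q m h => ?_⟩
  have hdvd : φ p ∣ φ d ^ m := ⟨φ q, by rw [← map_mul, h, map_pow]⟩
  obtain ⟨k, -, hk⟩ := (dvd_prime_pow hirr.prime m).1 hdvd
  obtain ⟨w, hw⟩ := hk.symm
  obtain ⟨c, hc, hcw⟩ := (MvPolynomial.isUnit_iff_eq_C_of_isReduced).1 w.isUnit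
  let s : Fin (n + 1) × Fin (n + 1) → A := fun x => (1 : Matrix _ _ A) x.1 x.2
  have hds : eval s d = 1 := by
    rw [hd]; refine (eval_det_X' (fun x => x) s).trans ?_
    exact Matrix.det_one
  have hev : ∀ r, eval (fun x => algebraMap A K (s x)) (φ r) = algebraMap A K (eval s r) := by
    intro r
    simp only [φ, eval_map, eval₂_comp]
    try rfl
  refine ⟨eval s p, k, hφ ?_⟩
  have h1 := congrArg (eval (fun x => algebraMap A K (s x))) hw
  rw [hcw, map_mul, map_pow, hev, hev, hds, map_one, one_pow, one_mul, eval_C] at h1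
  rw [← hw, hcw, h1, map_mul, map_pow, mul_comm]
  simp [φ]


/-- Let `A` be an integral domain, `n ≥ 1`, and let
`B = A[X_{ij}, 1/det]` be the localization of the polynomial ring away from the generic
determinant.  Then the map `Aˣ × ℤ → Bˣ`, `(a, k) ↦ a · det^k`, is a bijection:
every unit of `B` is uniquely of the form `a · det^k` with `a ∈ Aˣ`, `k ∈ ℤ`. -/
theorem units_localization_away_det_bijective
    (A : Type) [CommRing A] [IsDomain A] (n : ℕ) (hn : 1 ≤ n)
    (d : MvPolynomial (Fin n × Fin n) A)
    (hd : d = Matrix.det (Matrix.of fun i j : Fin n => MvPolynomial.X (i, j)))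
    (u : (Localization.Away d)ˣ)
    (hu : (u : Localization.Away d) = algebraMap (MvPolynomial (Fin n × Fin n) A) _ d) :
    Function.Bijective (fun p : Aˣ × ℤ =>
      Units.map (algebraMap A (Localization.Away d)).toMonoidHom p.1 * u ^ p.2) := by


  classical
  obtain ⟨n, rfl⟩ : ∃ m, n = m + 1 := ⟨n - 1, by omega⟩
  obtain ⟨hnu, hfac⟩ := factor_det_pow' A n d hd
  have hd0 : d ≠ 0 := by
    rw [hd]
    exact Matrix.det_mvPolynomialX_ne_zero (Fin (n + 1)) A
  set ι := algebraMap (MvPolynomial (Fin (n + 1) × Fin (n + 1)) A) (Localization.Away d) with hι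
  have hinj : Function.Injective ι :=
    IsLocalization.injective _ (powers_le_nonZeroDivisors_of_noZeroDivisors hd0)
  have hC : ∀ a : A, algebraMap A (Localization.Away d) a = ι (MvPolynomial.C a) := fun a =>
    IsScalarTower.algebraMap_apply A (MvPolynomial (Fin (n + 1) × Fin (n + 1)) A) _ a
  let s : Fin (n + 1) × Fin (n + 1) → A := fun x => (1 : Matrix _ _ A) x.1 x.2
  have hds : MvPolynomial.eval s d = 1 := by
    rw [hd]; refine (eval_det_X' (fun x => x) s).trans ?_
    exact Matrix.det_one
  constructor
  · let ψ : Localization.Away d →+* A :=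
      IsLocalization.Away.lift (g := MvPolynomial.eval s) d (by rw [hds]; exact isUnit_one)
    have hψ : ∀ r, ψ (ι r) = MvPolynomial.eval s r := fun r =>
      IsLocalization.Away.lift_eq d _ r
    have hψu : Units.map (ψ : Localization.Away d →* A) u = 1 := by
      ext
      simp only [Units.coe_map, MonoidHom.coe_coe, hu, hψ, hds, Units.val_one]
    have hψa : ∀ a : Aˣ, Units.map (ψ : Localization.Away d →* A)
        (Units.map (algebraMap A (Localization.Away d)).toMonoidHom a) = a := by
      intro a
      ext
      change ψ (algebraMap A _ (a : A)) = a
      rw [hC, hψ, MvPolynomial.eval_C]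
    rintro ⟨a, k⟩ ⟨b, l⟩ h
    dsimp only at h
    have hab : a = b := by
      have := congrArg (Units.map (ψ : Localization.Away d →* A)) h
      simpa only [map_mul, map_zpow, hψu, hψa, one_zpow, mul_one] using this
    subst hab
    have hkl := mul_left_cancel h
    have : Function.Injective fun k : ℤ => u ^ k := by
      rw [injective_zpow_iff_not_isOfFinOrder, isOfFinOrder_iff_pow_eq_one]
      rintro ⟨m, hm, hum⟩
      have h1 := congrArg Units.val hum
      rw [Units.val_pow_eq_pow_val, hu, ← map_pow, Units.val_one, ← map_one ι] at h1
      exact hnu (IsUnit.of_pow_eq_one (hinj h1) hm.ne')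
    rw [this hkl]
  · intro w
    obtain ⟨k, p, hp⟩ := IsLocalization.Away.surj d (w : Localization.Away d)
    obtain ⟨l, q, hq⟩ := IsLocalization.Away.surj d ((w⁻¹ : (Localization.Away d)ˣ) : Localization.Away d)
    have hpq : p * q = d ^ (k + l) := by
      apply hinj
      rw [map_mul, ← hp, ← hq, map_pow, pow_add, mul_mul_mul_comm, Units.mul_inv, one_mul]
    obtain ⟨a, i, rfl⟩ := hfac p q _ hpq
    obtain ⟨b, j, rfl⟩ := hfac q _ _ ((mul_comm _ _).trans hpq)
    have hab : a * b = 1 := by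
      have := congrArg (MvPolynomial.eval s) hpq
      simpa [hds] using this
    refine ⟨⟨⟨a, b, hab, (mul_comm _ _).trans hab⟩, (i : ℤ) - k⟩, ?_⟩
    dsimp only
    rw [zpow_sub, zpow_natCast, zpow_natCast, ← mul_assoc, mul_inv_eq_iff_eq_mul]
    ext
    push_cast
    rw [hu, hp, map_mul, map_pow, ← hC]
    rfl
end

section
/- Let A be an integral domain and let n ≥ 1 and p ≥ 1. Let R be the localization of the polynomial ring A[X^{(k)}_{ij} : 1 ≤ k ≤ p, 1 ≤ i, j ≤ n] at the element det₁ ⋯ det_p, where det_k denotes the determinant of the n × n matrix whose (i,j) entry is X^{(k)}_{ij}. Then the map A^× × ℤ^p → R^× sending (a, (m₁, …, m_p)) ↦ a · det₁^{m₁} ⋯ det_p^{m_p} is a bijection. -/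
open MvPolynomial in
theorem det_mem_supported_aux {K σ : Type} [CommRing K] {n : ℕ} (S : Subalgebra K (MvPolynomial σ K))
    (M : Matrix (Fin n) (Fin n) (MvPolynomial σ K)) (h : ∀ i j, M i j ∈ S) : M.det ∈ S := by
  rw [Matrix.det_apply]
  refine S.sum_mem fun g _ => ?_
  rw [Units.smul_def]
  exact S.zsmul_mem (S.prod_mem fun i _ => h _ _) _

open MvPolynomial in
theorem det_irreducible_aux {K σ : Type} [Field K] (m : ℕ) :
    ∀ (e : Fin (m + 1) × Fin (m + 1) → σ), Function.Injective e →
    Irreducible (Matrix.det (Matrix.of fun i j : Fin (m + 1) => (X (e (i, j)) : MvPolynomial σ K))) := by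
  induction m with
  | zero =>
    intro e he
    simpa using irreducible_mul_X_add (1 : MvPolynomial σ K) 0 (e (0, 0)) one_ne_zero
      (by simp) (by simp) isRelPrime_one_left
  | succ m ih =>
    intro e he
    have hmin := ih (fun q => e (q.1.succ, q.2.succ)) (by
      intro a b hab
      have := he hab
      simpa [Prod.ext_iff] using this)
    set f := Matrix.det (Matrix.of fun i j : Fin (m + 1) => (X (e (i.succ, j.succ)) : MvPolynomial σ K)) with hf
    set N : Matrix (Fin (m + 2)) (Fin (m + 2)) (MvPolynomial σ K) :=
      Matrix.of fun i j => if i = 0 ∧ j = 0 then 0 else X (e (i, j)) with hN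
    have key : Matrix.det (Matrix.of fun i j : Fin (m + 1 + 1) => (X (e (i, j)) : MvPolynomial σ K))
        = f * X (e (0, 0)) + N.det := by
      rw [Matrix.det_succ_row_zero, Matrix.det_succ_row_zero N, Fin.sum_univ_succ,
        Fin.sum_univ_succ (fun j => (-1) ^ (j : ℕ) * N 0 j * (N.submatrix Fin.succ j.succAbove).det)]
      have h0 : N 0 0 = 0 := by simp [hN]
      rw [h0]
      have h1 : ((Matrix.of fun i j : Fin (m + 1 + 1) => (X (e (i, j)) : MvPolynomial σ K)).submatrix
          Fin.succ (Fin.succAbove 0)).det = f := by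
        rw [hf]; congr 1
      rw [h1]
      have h2 : ∀ i : Fin (m + 1), N.submatrix Fin.succ i.succ.succAbove =
        (Matrix.of fun i j : Fin (m + 1 + 1) => (X (e (i, j)) : MvPolynomial σ K)).submatrix
          Fin.succ i.succ.succAbove := by
        intro i; ext1 a b; simp [hN]
      have h3 : ∀ i : Fin (m + 1), N 0 i.succ = X (e (0, i.succ)) := by
        intro i; simp [hN]
      simp only [h2, h3, Matrix.of_apply]
      simp
      ring
    rw [key]
    have hS : ∀ g : MvPolynomial σ K, g ∈ supported K ({e (0, 0)}ᶜ : Set σ) → e (0, 0) ∉ g.vars := by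
      intro g hg hh
      rw [mem_supported] at hg
      exact hg hh rfl
    refine irreducible_mul_X_add _ _ _ hmin.ne_zero (hS _ ?_) (hS _ ?_) ?_
    · refine det_mem_supported_aux _ _ fun i j => ?_
      simp only [Matrix.of_apply]
      rw [X_mem_supported]
      intro h
      have := he h
      simp at this
    · refine det_mem_supported_aux _ _ fun i j => ?_
      simp only [hN, Matrix.of_apply]
      split_ifs with h
      · exact Subalgebra.zero_mem _
      · rw [X_mem_supported]
        intro h'
        have := he h'
        simp at this
        exact h this
    · refine (hmin.isRelPrime_iff_not_dvd).2 fun hdvd => ?_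
      let P : Matrix (Fin (m + 2)) (Fin (m + 2)) K := (Equiv.swap (0 : Fin (m + 2)) 1).permMatrix K
      let s : σ → K := Function.extend e (fun q => P q.1 q.2) 0
      have hs : ∀ i j, s (e (i, j)) = P i j := fun i j => he.extend_apply _ _ _
      have hd := map_dvd (MvPolynomial.eval s) hdvd
      rw [hf, RingHom.map_det, RingHom.map_det] at hd
      have e1 : (MvPolynomial.eval s).mapMatrix N = P := by
        ext i j
        simp only [hN, RingHom.mapMatrix_apply, Matrix.map_apply, Matrix.of_apply]
        split_ifs with h
        · simp [P, h.1, h.2, Equiv.Perm.permMatrix, PEquiv.toMatrix_apply]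
        · simp [hs]
      rw [e1] at hd
      have e2 : Matrix.det ((MvPolynomial.eval s).mapMatrix (Matrix.of fun i j : Fin (m + 1) => (X (e (i.succ, j.succ)) : MvPolynomial σ K))) = 0 := by
        refine Matrix.det_eq_zero_of_row_eq_zero 0 fun j => ?_
        simp [hs, P, Equiv.Perm.permMatrix, PEquiv.toMatrix_apply]
        exact (Fin.succ_ne_zero j).symm
      rw [e2, zero_dvd_iff] at hd
      simp only [P, Matrix.det_permutation] at hd
      rcases Int.units_eq_one_or (Equiv.Perm.sign (Equiv.swap (0 : Fin (m + 2)) 1)) with h | h <;>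
        rw [h] at hd <;> simp at hd

open MvPolynomial in
theorem factor_aux {K σ : Type} [Field K] {p : ℕ} (d : Fin p → MvPolynomial σ K)
    (hd : ∀ k, Prime (d k)) (M : ℕ) (f g : MvPolynomial σ K) (h : f * g = (∏ k, d k) ^ M) :
    ∃ (c : K) (m : Fin p → ℕ), f = C c * ∏ k, d k ^ m k := by
  classical
  have h' : f * g = 1 * ∏ q ∈ (Finset.univ : Finset (Fin p × Fin M)), d q.1 := by
    rw [h, one_mul, ← Finset.univ_product_univ, Finset.prod_product, ← Finset.prod_pow]
    simp
  obtain ⟨t, u, b, c, -, -, hbc, hf, -⟩ := mul_eq_mul_prime_prod (fun i _ => hd i.1) h'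
  obtain ⟨r, -, rfl⟩ := isUnit_iff_eq_C_of_isReduced.1 (IsUnit.of_mul_eq_one c hbc.symm)
  refine ⟨r, fun k => (t.filter fun q => q.1 = k).card, ?_⟩
  rw [hf, ← Finset.prod_fiberwise t (fun q => q.1)]
  congr 1
  refine Finset.prod_congr rfl fun k _ => ?_
  rw [Finset.prod_congr rfl (g := fun _ => d k), Finset.prod_const]
  intro q hq
  rw [(Finset.mem_filter.1 hq).2]

theorem laurent_zpow_aux {A : Type} [CommRing A] (v : (LaurentPolynomial A)ˣ)
    (hv : (v : LaurentPolynomial A) = LaurentPolynomial.T 1) (m : ℤ) :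
    ((v ^ m : (LaurentPolynomial A)ˣ) : LaurentPolynomial A) = LaurentPolynomial.T m := by
  have hnat : ∀ k : ℕ, ((v ^ k : (LaurentPolynomial A)ˣ) : LaurentPolynomial A) = LaurentPolynomial.T k := by
    intro k
    simp [hv, LaurentPolynomial.T_pow]
  obtain ⟨k, rfl | rfl⟩ := m.eq_nat_or_neg
  · rw [zpow_natCast]; exact hnat k
  · rw [zpow_neg, zpow_natCast, Units.inv_eq_of_mul_eq_one_right]
    rw [hnat, ← LaurentPolynomial.T_add]
    simp


/-- Let `A` be an integral domain, `n, p ≥ 1`, and let `R` be the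
localization of the polynomial ring in the `p · n²` variables `X^{(k)}_{ij}` at the
product `det₁ ⋯ det_p` of the block determinants.  Then the map
`Aˣ × ℤ^p → Rˣ`, `(a, (m₁, …, m_p)) ↦ a · det₁^{m₁} ⋯ det_p^{m_p}`, is a bijection. -/
theorem units_localization_away_prod_det_bijective
    (A : Type) [CommRing A] [IsDomain A] (n p : ℕ) (hn : 1 ≤ n) (hp : 1 ≤ p)
    (d : Fin p → MvPolynomial (Fin p × Fin n × Fin n) A)
    (hd : ∀ k, d k = Matrix.det (Matrix.of fun i j : Fin n => MvPolynomial.X (k, i, j)))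
    (u : Fin p → (Localization.Away (∏ k, d k))ˣ)
    (hu : ∀ k, (u k : Localization.Away (∏ k, d k)) =
      algebraMap (MvPolynomial (Fin p × Fin n × Fin n) A) _ (d k)) :
    Function.Bijective (fun q : Aˣ × (Fin p → ℤ) =>
      Units.map (algebraMap A (Localization.Away (∏ k, d k))).toMonoidHom q.1 *
        ∏ k, (u k) ^ (q.2 k)) := by
  classical
  obtain ⟨n, rfl⟩ : ∃ n', n = n' + 1 := ⟨n - 1, by omega⟩
  -- evaluation of determinants along ring homs
  have hev : ∀ (S : Type) [CommRing S] [Algebra A S] (s : Fin p × Fin (n+1) × Fin (n+1) → S) (k),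
      MvPolynomial.aeval s (d k) = Matrix.det (Matrix.of fun i j => s (k, i, j)) := by
    intro S _ _ s k
    rw [hd, AlgHom.map_det]
    congr 1
    ext i j
    simp
  let s1 : Fin p × Fin (n+1) × Fin (n+1) → A := fun q => if q.2.1 = q.2.2 then 1 else 0
  have hs1 : ∀ k, MvPolynomial.aeval s1 (d k) = 1 := by
    intro k
    rw [hev, ← Matrix.det_one (n := Fin (n+1)) (R := A)]
    congr 1
  have hd0 : ∀ k, d k ≠ 0 := by
    intro k h
    have := hs1 k
    simp [h] at this
  have hD0 : (∏ k, d k) ≠ 0 := Finset.prod_ne_zero_iff.2 fun k _ => hd0 k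
  have hinj : Function.Injective (algebraMap (MvPolynomial (Fin p × Fin (n+1) × Fin (n+1)) A)
      (Localization.Away (∏ k, d k))) :=
    IsLocalization.injective _ (powers_le_nonZeroDivisors_of_noZeroDivisors hD0)
  constructor
  · rintro ⟨a, m⟩ ⟨b, m'⟩ hab
    have main : ∀ k0 : Fin p, LaurentPolynomial.C (a : A) * LaurentPolynomial.T (m k0) =
        LaurentPolynomial.C (b : A) * LaurentPolynomial.T (m' k0) := by
      intro k0
      let s : Fin p × Fin (n+1) × Fin (n+1) → LaurentPolynomial A := fun q =>
        Matrix.diagonal (fun i => if q.1 = k0 ∧ i = 0 then LaurentPolynomial.T 1 else 1) q.2.1 q.2.2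
      have hs : ∀ k, MvPolynomial.aeval s (d k) =
          if k = k0 then (LaurentPolynomial.T 1 : LaurentPolynomial A) else 1 := by
        intro k
        rw [hev]
        have : (Matrix.of fun i j => s (k, i, j)) = Matrix.diagonal
          (fun i => if k = k0 ∧ i = 0 then (LaurentPolynomial.T 1 : LaurentPolynomial A) else 1) := by
          ext1 i j; rfl
        rw [this, Matrix.det_diagonal, Fin.prod_univ_succ]
        simp
      have hDs : MvPolynomial.aeval s (∏ k, d k) = (LaurentPolynomial.T 1 : LaurentPolynomial A) := by
        rw [map_prod]
        simp [hs]
      have hunit : IsUnit ((MvPolynomial.aeval s : _ →ₐ[A] LaurentPolynomial A).toRingHom (∏ k, d k)) := by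
        have := LaurentPolynomial.isUnit_T (R := A) 1
        rw [← hDs] at this
        exact this
      let φ : Localization.Away (∏ k, d k) →+* LaurentPolynomial A :=
        IsLocalization.Away.lift (∏ k, d k) hunit
      have hφ : ∀ x, φ (algebraMap _ _ x) = MvPolynomial.aeval s x := fun x =>
        IsLocalization.Away.lift_eq (∏ k, d k) hunit x
      obtain ⟨v, hv⟩ := LaurentPolynomial.isUnit_T (R := A) 1
      have hφu : ∀ k, Units.map φ.toMonoidHom (u k) = if k = k0 then v else 1 := by
        intro k
        ext1
        have : ((Units.map φ.toMonoidHom (u k) : (LaurentPolynomial A)ˣ) : LaurentPolynomial A) =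
          φ (u k) := rfl
        rw [this, hu, hφ, hs]
        split_ifs <;> simp [hv]
      have hφa : ∀ a : A, φ (algebraMap A _ a) = LaurentPolynomial.C a := by
        intro a
        rw [IsScalarTower.algebraMap_apply A (MvPolynomial (Fin p × Fin (n+1) × Fin (n+1)) A), hφ]
        rw [AlgHom.commutes]
        rfl
      have hval : ∀ (a : Aˣ) (m : Fin p → ℤ), ((Units.map φ.toMonoidHom
          (Units.map (algebraMap A (Localization.Away (∏ k, d k))).toMonoidHom a *
          ∏ k, (u k) ^ (m k)) : (LaurentPolynomial A)ˣ) : LaurentPolynomial A) =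
          LaurentPolynomial.C (a : A) * LaurentPolynomial.T (m k0) := by
        intro a m
        rw [map_mul, map_prod, Units.val_mul]
        congr 1
        · exact hφa a
        · simp only [map_zpow, hφu]
          rw [Finset.prod_eq_single k0]
          · simp only [if_true]
            exact laurent_zpow_aux v hv _
          · intro b _ hb
            simp [hb]
          · simp
      have := congrArg (fun x => ((Units.map φ.toMonoidHom x : (LaurentPolynomial A)ˣ) : LaurentPolynomial A)) hab
      simp only [hval] at this
      exact this
    have hk : ∀ k, m k = m' k ∧ (a : A) = b := by
      intro k
      have h := main k
      rw [← LaurentPolynomial.single_eq_C_mul_T, ← LaurentPolynomial.single_eq_C_mul_T] at h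
      have h' := congrArg AddMonoidAlgebra.coeff h
      simp only [AddMonoidAlgebra.coeff_single] at h'
      rcases (Finsupp.single_eq_single_iff _ _ _ _).1 h' with h | h
      · exact h
      · exact absurd h.1 a.ne_zero
    refine Prod.ext (Units.ext (hk ⟨0, hp⟩).2) (funext fun k => (hk k).1)
  · intro x
    obtain ⟨N, f, hf⟩ := IsLocalization.Away.surj (∏ k, d k) (x : Localization.Away (∏ k, d k))
    obtain ⟨N', g, hg⟩ := IsLocalization.Away.surj (∏ k, d k) ((x⁻¹ : (Localization.Away (∏ k, d k))ˣ) : Localization.Away (∏ k, d k))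
    have hfg : f * g = (∏ k, d k) ^ (N + N') := by
      apply hinj
      rw [map_mul, ← hf, ← hg, map_pow, pow_add, mul_mul_mul_comm, Units.mul_inv, one_mul]
    let K := FractionRing A
    let ι := MvPolynomial.map (σ := Fin p × Fin (n+1) × Fin (n+1)) (algebraMap A K)
    have hι : Function.Injective ι := MvPolynomial.map_injective _ (IsFractionRing.injective A K)
    have hprime : ∀ k, Prime (ι (d k)) := by
      intro k
      have := det_irreducible_aux (K := K) n (fun q => (k, q.1, q.2)) (by
        intro a b hab
        simpa [Prod.ext_iff] using hab)
      have h2 : ι (d k) = Matrix.det (Matrix.of fun i j : Fin (n + 1) =>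
          (MvPolynomial.X (k, i, j) : MvPolynomial (Fin p × Fin (n+1) × Fin (n+1)) K)) := by
        rw [hd, RingHom.map_det]
        congr 1
        ext1 i j
        simp [ι]
      rw [h2]
      exact this.prime
    obtain ⟨c, m, hc⟩ := factor_aux (fun k => ι (d k)) hprime (N + N') (ι f) (ι g) (by
      rw [← map_mul, hfg, map_pow, map_prod])
    have hc1 : c = algebraMap A K (MvPolynomial.aeval s1 f) := by
      have h3 : ∀ q, MvPolynomial.eval (fun i => algebraMap A K (s1 i)) (ι q) =
          algebraMap A K (MvPolynomial.aeval s1 q) := by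
        intro q
        rw [MvPolynomial.eval_map, MvPolynomial.aeval_def, MvPolynomial.hom_eval₂]
        rfl
      have h4 := congrArg (MvPolynomial.eval (fun i => algebraMap A K (s1 i))) hc
      rw [h3] at h4
      simp only [map_mul, map_prod, map_pow, h3, hs1, MvPolynomial.eval_C] at h4
      simpa using h4.symm
    have hf' : f = MvPolynomial.C (MvPolynomial.aeval s1 f) * ∏ k, d k ^ m k := by
      apply hι
      rw [hc, map_mul, map_prod, hc1]
      simp [ι]
    have ha : IsUnit (MvPolynomial.aeval s1 f) := by
      refine IsUnit.of_mul_eq_one (MvPolynomial.aeval s1 g) ?_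
      rw [← map_mul, hfg, map_pow, map_prod]
      simp [hs1]
    obtain ⟨a, ha⟩ := ha
    refine ⟨(a, fun k => (m k : ℤ) - N), ?_⟩
    have hx : x * (∏ k, u k) ^ N =
        Units.map (algebraMap A (Localization.Away (∏ k, d k))).toMonoidHom a * ∏ k, u k ^ m k := by
      ext1
      rw [hf', ← ha] at hf
      simp only [Units.val_mul, Units.val_pow_eq_pow_val, Units.coe_prod, hu]
      rw [← map_prod, hf, map_mul, map_prod]
      simp only [map_pow]
      congr 1
    rw [← eq_mul_inv_iff_mul_eq] at hx
    rw [hx]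
    simp only [zpow_sub, zpow_natCast, Finset.prod_mul_distrib, Finset.prod_inv_distrib, Finset.prod_pow, mul_assoc]
end

section
/- Let A be a Noetherian integrally closed (normal) domain. Then the pullback homomorphism Pic(A) → Pic(A[t^{±1}]) along the inclusion A → A[t^{±1}] is an isomorphism; equivalently, every invertible module over the Laurent polynomial ring A[t^{±1}] is, up to isomorphism, extended from A, i.e., of the form A[t^{±1}] ⊗_A M for an invertible A-module M, and two invertible A-modules with isomorphic extensions are isomorphic. -/
/-- An `R`-module `M` is *invertible* if it admits a tensor inverse, i.e. there is an
`R`-module `N` with `M ⊗[R] N ≅ R`.  (This is equivalent to `M` being finitely generated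
projective of constant rank one.) -/
def IsInvertibleModule (R M : Type) [CommRing R] [AddCommGroup M] [Module R M] : Prop :=
  ∃ (N : Type) (_ : AddCommGroup N) (_ : Module R N),
    Nonempty (TensorProduct R M N ≃ₗ[R] R)

namespace PicLaurent

open scoped LaurentPolynomial AlgebraMonoidAlgebra TensorProduct

/-- The coefficient of a product of Laurent polynomials. -/
lemma coeff_mul_laurent {K : Type*} [CommRing K] (f g : K[T;T⁻¹]) (n : ℤ) :
    (f * g).coeff n = ∑ i ∈ f.coeff.support, f.coeff i * g.coeff (n - i) := by
  classical
  rw [AddMonoidAlgebra.coeff_mul, Finsupp.sum]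
  refine Finset.sum_congr rfl fun i _ => ?_
  rw [Finsupp.sum]
  simp_rw [← eq_sub_iff_add_eq']
  rw [Finset.sum_ite_eq']
  split_ifs with h
  · rfl
  · rw [Finsupp.notMem_support_iff.mp h, mul_zero]

lemma exists_dominant {K : Type*} [Field K] {Γ : Type*} [LinearOrderedCommGroupWithZero Γ]
    (v : Valuation K Γ) (f : K[T;T⁻¹]) (hf : f ≠ 0) :
    ∃ i₀, f.coeff i₀ ≠ 0 ∧ (∀ i, v (f.coeff i) ≤ v (f.coeff i₀)) ∧
      ∀ i, i₀ < i → v (f.coeff i) < v (f.coeff i₀) := by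
  have hne : f.coeff.support.Nonempty := by
    rw [Finsupp.support_nonempty_iff]
    intro h
    exact hf (LaurentPolynomial.ext fun a => by simp [h])
  obtain ⟨i₀, hi₀, hmax⟩ := Finset.exists_max_image f.coeff.support
    (fun i => toLex (v (f.coeff i), i)) hne
  have h0 : f.coeff i₀ ≠ 0 := Finsupp.mem_support_iff.mp hi₀
  have hpos : 0 < v (f.coeff i₀) := zero_lt_iff.mpr (by simpa using h0)
  refine ⟨i₀, h0, fun i => ?_, fun i hi => ?_⟩
  · by_cases h : f.coeff i = 0
    · simp [h]
    · have := hmax i (Finsupp.mem_support_iff.mpr h)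
      rw [Prod.Lex.toLex_le_toLex] at this
      rcases this with h | h
      · exact h.le
      · exact h.1.le
  · by_cases h : f.coeff i = 0
    · simpa [h] using hpos
    · have := hmax i (Finsupp.mem_support_iff.mpr h)
      rw [Prod.Lex.toLex_le_toLex] at this
      rcases this with h | h
      · exact h
      · exact absurd h.2 (not_le.mpr hi)

/-- The Gauss lemma for a valuation subring. -/
lemma gauss_valuation {K : Type*} [Field K] (V : ValuationSubring K) (f g : K[T;T⁻¹])
    (h : ∀ n, (f * g).coeff n ∈ V) (i j : ℤ) : f.coeff i * g.coeff j ∈ V := by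
  by_cases hf : f = 0
  · simp [hf]
  by_cases hg : g = 0
  · simp [hg]
  obtain ⟨i₀, hi0, hi1, hi2⟩ := exists_dominant V.valuation f hf
  obtain ⟨j₀, hj0, hj1, hj2⟩ := exists_dominant V.valuation g hg
  set v := V.valuation
  have hfpos : 0 < v (f.coeff i₀) := zero_lt_iff.mpr (by simpa using hi0)
  have hgpos : 0 < v (g.coeff j₀) := zero_lt_iff.mpr (by simpa using hj0)
  have hsum := coeff_mul_laurent f g (i₀ + j₀)
  rw [← Finset.add_sum_erase _ _ (Finsupp.mem_support_iff.mpr hi0), add_sub_cancel_left] at hsum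
  have hlt : v (∑ x ∈ f.coeff.support.erase i₀, f.coeff x * g.coeff (i₀ + j₀ - x)) <
      v (f.coeff i₀ * g.coeff j₀) := by
    apply Valuation.map_sum_lt
    · simp [hi0, hj0]
    · intro x hx
      rw [map_mul, map_mul]
      rcases lt_or_gt_of_ne (Finset.ne_of_mem_erase hx) with hlt | hlt
      · exact mul_lt_mul_of_le_of_lt_of_nonneg_of_pos (hi1 x) (hj2 _ (by omega)) zero_le hfpos
      · exact mul_lt_mul_of_lt_of_le_of_nonneg_of_pos (hi2 x hlt) (hj1 _) zero_le hgpos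
  have h1 : v (f.coeff i₀ * g.coeff j₀) ≤ 1 := by
    rw [← Valuation.map_add_eq_of_lt_left v hlt, ← hsum]
    exact (V.valuation_le_one_iff _).mpr (h _)
  rw [← V.valuation_le_one_iff]
  refine le_trans ?_ h1
  rw [map_mul, map_mul]
  exact mul_le_mul' (hi1 i) (hj1 j)

/-- Kronecker's theorem: The Gauss lemma for an integrally closed domain. -/
lemma kronecker (A K : Type*) [CommRing A] [IsDomain A] [IsIntegrallyClosed A] [Field K]
    [Algebra A K] [IsFractionRing A K] (f g : K[T;T⁻¹])
    (h : ∀ n, (f * g).coeff n ∈ (algebraMap A K).range) (i j : ℤ) :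
    f.coeff i * g.coeff j ∈ (algebraMap A K).range := by
  have : IsIntegrallyClosedIn (algebraMap A K).range K := by
    rw [isIntegrallyClosedIn_iff]
    refine ⟨Subtype.val_injective, fun {x} hx => ?_⟩
    have hx' : IsIntegral A x := by
      obtain ⟨p, hp, hpx⟩ := hx
      obtain ⟨q, hq, -, hqm⟩ := Polynomial.lifts_and_natDegree_eq_and_monic
        (f := (algebraMap A K).rangeRestrict) (p := p)
        (Polynomial.map_surjective _ (RingHom.rangeRestrict_surjective _) p) hp
      refine ⟨q, hqm, ?_⟩
      rw [← hpx, ← hq, Polynomial.eval₂_map]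
      rfl
    obtain ⟨y, hy⟩ := IsIntegrallyClosed.isIntegral_iff.mp hx'
    exact ⟨⟨x, y, hy⟩, rfl⟩
  by_contra hxR
  obtain ⟨V, hV, hx⟩ := Subring.exists_le_valuationSubring_of_isIntegrallyClosedIn hxR
  exact hx (gauss_valuation V f g (fun n => hV (h n)) i j)

lemma algebraMap_coeff (A K : Type*) [CommRing A] [CommRing K] [Algebra A K] (f : A[T;T⁻¹])
    (n : ℤ) : (algebraMap A[T;T⁻¹] K[T;T⁻¹] f).coeff n = algebraMap A K (f.coeff n) := by
  simp [AddMonoidAlgebra.algebraMap_def]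

lemma laurent_eq_sum {K : Type*} [CommRing K] (f : K[T;T⁻¹]) :
    f = f.coeff.sum fun n a => AddMonoidAlgebra.single n a := by
  exact (AddMonoidAlgebra.sum_coeff_single f).symm

lemma mem_range_of_coeff (A K : Type*) [CommRing A] [CommRing K] [Algebra A K] (f : K[T;T⁻¹])
    (h : ∀ n, f.coeff n ∈ (algebraMap A K).range) :
    f ∈ (algebraMap A[T;T⁻¹] K[T;T⁻¹]).range := by
  choose c hc using h
  have : f = f.coeff.sum fun n a => AddMonoidAlgebra.single n a := (laurent_eq_sum f)
  rw [this]
  refine sum_mem fun n _ => ⟨AddMonoidAlgebra.single n (c n), ?_⟩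
  simp only [AddMonoidAlgebra.algebraMap_def]
  simp [hc, -LaurentPolynomial.single_eq_C_mul_T]

instance pic_laurent_field (K : Type*) [Field K] : Subsingleton (CommRing.Pic K[T;T⁻¹]) := by
  have hd : IsDomain K[T;T⁻¹] := inferInstance
  have : UniqueFactorizationMonoid K[T;T⁻¹] :=
    UniqueFactorizationMonoid.of_isLocalization
      (Submonoid.powers (Polynomial.X : Polynomial K)) K[T;T⁻¹]
  infer_instance


variable (A K : Type) [CommRing A] [IsDomain A] [IsIntegrallyClosed A] [Field K]
    [Algebra A K] [IsFractionRing A K]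

/-- The `A`-submodule of `K` generated by all coefficients of elements of `I`. -/
def contentSub (I : Submodule A[T;T⁻¹] K[T;T⁻¹]) : Submodule A K :=
  Submodule.span A {x | ∃ f ∈ I, ∃ n : ℤ, f.coeff n = x}

variable {A K}

lemma coeff_mem_contentSub {I : Submodule A[T;T⁻¹] K[T;T⁻¹]} {f : K[T;T⁻¹]} (hf : f ∈ I) (n : ℤ) :
    f.coeff n ∈ contentSub A K I := Submodule.subset_span ⟨f, hf, n, rfl⟩

lemma contentSub_mul_le {I I' : Submodule A[T;T⁻¹] K[T;T⁻¹]} (h : I * I' = 1) :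
    contentSub A K I * contentSub A K I' ≤ 1 := by
  rw [contentSub, contentSub, Submodule.span_mul_span, Submodule.span_le]
  rintro _ ⟨_, ⟨f, hf, i, rfl⟩, _, ⟨g, hg, j, rfl⟩, rfl⟩
  have hfg : f * g ∈ (1 : Submodule A[T;T⁻¹] K[T;T⁻¹]) := h ▸ Submodule.mul_mem_mul hf hg
  obtain ⟨p, hp⟩ := Submodule.mem_one.mp hfg
  obtain ⟨a, ha⟩ := kronecker A K f g (fun n => ⟨p.coeff n, by rw [← hp, algebraMap_coeff]⟩) i j
  exact Submodule.mem_one.mpr ⟨a, ha⟩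

lemma le_contentSub_mul {I I' : Submodule A[T;T⁻¹] K[T;T⁻¹]} (h : I * I' = 1) :
    1 ≤ contentSub A K I * contentSub A K I' := by
  have key : ∀ x ∈ I * I', ∀ n : ℤ, x.coeff n ∈ contentSub A K I * contentSub A K I' := by
    intro x hx
    induction hx using Submodule.mul_induction_on' with
    | mem_mul_mem f hf g hg =>
      intro n
      rw [coeff_mul_laurent]
      exact sum_mem fun i _ =>
        Submodule.mul_mem_mul (coeff_mem_contentSub hf _) (coeff_mem_contentSub hg _)
    | add x _ y _ hx hy =>
      intro n
      exact add_mem (hx n) (hy n)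
  have h1 := key 1 (h ▸ Submodule.one_le.mp le_rfl) 0
  rw [Submodule.one_le]
  have h2 : (1 : K[T;T⁻¹]).coeff 0 = 1 := by
    rw [← map_one LaurentPolynomial.C, LaurentPolynomial.C_apply]; simp
  rwa [h2] at h1

lemma C_mem {I I' : Submodule A[T;T⁻¹] K[T;T⁻¹]} (h : I * I' = 1) {x : K}
    (hx : x ∈ contentSub A K I) : (LaurentPolynomial.C x : K[T;T⁻¹]) ∈ I := by
  have key : ∀ y ∈ I * I', LaurentPolynomial.C x * y ∈ I := by
    intro y hy
    induction hy using Submodule.mul_induction_on' with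
    | mem_mul_mem f hf g hg =>
      obtain ⟨p, hp⟩ := mem_range_of_coeff A K (LaurentPolynomial.C x * g) (fun n => by
        have : (LaurentPolynomial.C x * g).coeff n = x * g.coeff n := by
          rw [← LaurentPolynomial.smul_eq_C_mul]; rfl
        rw [this]
        obtain ⟨a, ha⟩ := Submodule.mem_one.mp
          (contentSub_mul_le h (Submodule.mul_mem_mul hx (coeff_mem_contentSub hg n)))
        exact ⟨a, ha⟩)
      have : LaurentPolynomial.C x * (f * g) = p • f := by
        rw [Algebra.smul_def, hp]; ring
      rw [this]
      exact I.smul_mem _ hf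
    | add x _ y _ hx hy => rw [mul_add]; exact add_mem hx hy
  simpa using key 1 (h ▸ Submodule.one_le.mp le_rfl)

theorem main_aux [FaithfulSMul A[T;T⁻¹] K[T;T⁻¹]] (I : (Submodule A[T;T⁻¹] K[T;T⁻¹])ˣ) :
    ∃ J : (Submodule A K)ˣ, Nonempty (I ≃ₗ[A[T;T⁻¹]] (A[T;T⁻¹] ⊗[A] J)) := by
  have h1 : contentSub A K I * contentSub A K ↑I⁻¹ = 1 :=
    le_antisymm (contentSub_mul_le I.mul_inv) (le_contentSub_mul I.mul_inv)
  let J : (Submodule A K)ˣ := ⟨contentSub A K I, contentSub A K ↑I⁻¹, h1, (mul_comm _ _).trans h1⟩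
  have : IsScalarTower A A[T;T⁻¹] K[T;T⁻¹] := IsScalarTower.of_algebraMap_eq fun a => by
    ext n
    rw [algebraMap_coeff, LaurentPolynomial.algebraMap_apply, LaurentPolynomial.algebraMap_apply,
      LaurentPolynomial.C_apply, LaurentPolynomial.C_apply]
    split_ifs <;> simp
  let l : J.1 →ₗ[A] I.1 :=
    { toFun := fun x => ⟨LaurentPolynomial.C x.1, C_mem I.mul_inv x.2⟩
      map_add' := fun x y => by ext1; simp
      map_smul' := fun a x => by
        ext1
        simp [Algebra.smul_def, LaurentPolynomial.algebraMap_apply] }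
  let φ : A[T;T⁻¹] ⊗[A] J.1 →ₗ[A[T;T⁻¹]] I.1 := l.liftBaseChange A[T;T⁻¹]
  have hφ : Function.Surjective φ := by
    rintro ⟨f, hf⟩
    refine ⟨∑ n ∈ f.coeff.support, LaurentPolynomial.T n ⊗ₜ
      (⟨f.coeff n, coeff_mem_contentSub hf n⟩ : J.1), ?_⟩
    ext1
    rw [map_sum, AddSubmonoidClass.coe_finsetSum]
    refine Eq.trans ?_ (laurent_eq_sum f).symm
    refine Finset.sum_congr rfl fun n _ => ?_
    have : (algebraMap A[T;T⁻¹] K[T;T⁻¹]) (LaurentPolynomial.T n) = LaurentPolynomial.T n := by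
      ext m
      rw [algebraMap_coeff, LaurentPolynomial.T_apply, LaurentPolynomial.T_apply]
      split_ifs <;> simp
    rw [LinearMap.liftBaseChange_tmul, Submodule.coe_smul, Algebra.smul_def, this, mul_comm]
    exact (LaurentPolynomial.single_eq_C_mul_T _ _).symm
  have : FaithfulSMul A K :=
    (faithfulSMul_iff_algebraMap_injective _ _).mpr (IsFractionRing.injective A K)
  have hJ : Module.Invertible A J.1 := .left (Submodule.tensorInvEquiv J)
  have hI : Module.Invertible A[T;T⁻¹] I.1 := .left (Submodule.tensorInvEquiv I)
  exact ⟨J, ⟨(LinearEquiv.ofBijective φ (Module.Invertible.bijective_of_surjective hφ)).symm⟩⟩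

theorem surj_part (A : Type) [CommRing A] [IsDomain A] [IsIntegrallyClosed A]
    (P : Type) [AddCommGroup P] [Module (LaurentPolynomial A) P]
    (hP : IsInvertibleModule (LaurentPolynomial A) P) :
    ∃ (M : Type) (_ : AddCommGroup M) (_ : Module A M),
      IsInvertibleModule A M ∧
      Nonempty (P ≃ₗ[LaurentPolynomial A] TensorProduct A (LaurentPolynomial A) M) := by
  obtain ⟨N, _, _, ⟨e⟩⟩ := hP
  have : Module.Invertible (LaurentPolynomial A) P := .left e
  let K := FractionRing A
  have hinj : Function.Injective (algebraMap (LaurentPolynomial A) (LaurentPolynomial K)) := by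
    intro f g hfg
    ext n
    apply IsFractionRing.injective A K
    rw [← algebraMap_coeff, ← algebraMap_coeff, hfg]
  have : FaithfulSMul (LaurentPolynomial A) (LaurentPolynomial K) :=
    (faithfulSMul_iff_algebraMap_injective _ _).mpr hinj
  have hP : CommRing.Pic.mk (LaurentPolynomial A) P ∈
      CommRing.relPic (LaurentPolynomial A) (LaurentPolynomial K) := by
    rw [CommRing.relPic_eq_top]; trivial
  rw [← Submodule.range_unitsToPic] at hP
  obtain ⟨I, hI⟩ := hP
  obtain ⟨e1⟩ := CommRing.Pic.mk_eq_mk_iff.mp hI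
  obtain ⟨J, ⟨e2⟩⟩ := main_aux (A := A) (K := K) I
  exact ⟨J, inferInstance, inferInstance,
    ⟨_, inferInstance, inferInstance, ⟨Submodule.tensorInvEquiv J⟩⟩, ⟨e1.symm ≪≫ₗ e2⟩⟩

end PicLaurent

/-- Let `A` be a Noetherian integrally closed (normal) domain.  Then
`Pic(A) → Pic(A[t^{±1}])` is an isomorphism: every invertible module over the Laurent
polynomial ring `A[t^{±1}]` is extended from an invertible `A`-module, and two
invertible `A`-modules with isomorphic extensions are isomorphic. -/
theorem picardGroup_laurentPolynomial_of_noetherian_normal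
    (A : Type) [CommRing A] [IsDomain A] [IsNoetherianRing A] [IsIntegrallyClosed A] :
    (∀ (P : Type) [AddCommGroup P] [Module (LaurentPolynomial A) P],
      IsInvertibleModule (LaurentPolynomial A) P →
      ∃ (M : Type) (_ : AddCommGroup M) (_ : Module A M),
        IsInvertibleModule A M ∧
        Nonempty (P ≃ₗ[LaurentPolynomial A]
          TensorProduct A (LaurentPolynomial A) M)) ∧
    (∀ (M M' : Type) [AddCommGroup M] [Module A M] [AddCommGroup M'] [Module A M'],
      IsInvertibleModule A M → IsInvertibleModule A M' →
      Nonempty ((TensorProduct A (LaurentPolynomial A) M) ≃ₗ[LaurentPolynomial A]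
        (TensorProduct A (LaurentPolynomial A) M')) →
      Nonempty (M ≃ₗ[A] M')) := by
  constructor
  · intro P _ _ hP
    exact PicLaurent.surj_part A P hP
  · intro M M' _ _ _ _ ⟨N, _, _, ⟨e⟩⟩ ⟨N', _, _, ⟨e'⟩⟩ ⟨E⟩
    have : Module.Invertible A M := .left e
    have : Module.Invertible A M' := .left e'
    let ev : LaurentPolynomial A →+* A := LaurentPolynomial.eval₂ (RingHom.id A) 1
    have hev : ev.comp (algebraMap A (LaurentPolynomial A)) = RingHom.id A := by
      ext a
      simp [ev]
    let := ev.toAlgebra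
    have : IsScalarTower A (LaurentPolynomial A) A := .of_algebraMap_eq fun a =>
      (RingHom.congr_fun hev a).symm
    exact ⟨(TensorProduct.lid A M).symm ≪≫ₗ
      ((TensorProduct.AlgebraTensorModule.cancelBaseChange A (LaurentPolynomial A) A A M).symm ≪≫ₗ
      TensorProduct.AlgebraTensorModule.congr (.refl A A) E ≪≫ₗ
      TensorProduct.AlgebraTensorModule.cancelBaseChange A (LaurentPolynomial A) A A M') ≪≫ₗ
      TensorProduct.lid A M'⟩
end

section
/- Let A be a Noetherian integrally closed (normal) domain, and let n ≥ 1 and p ≥ 1. Let R be the localization of the polynomial ring A[X^{(k)}_{ij} : 1 ≤ k ≤ p, 1 ≤ i, j ≤ n] at det₁ ⋯ det_p, where det_k is the determinant of the n × n matrix whose (i,j) entry is X^{(k)}_{ij}. Then the pullback homomorphism Pic(A) → Pic(R) is an isomorphism. -/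
open MvPolynomial in
theorem aux_normalize {K σ : Type*} [Field K] (V : ValuationSubring K) (f : MvPolynomial σ K)
    (hf : f ≠ 0) : ∃ (a : K) (F : MvPolynomial σ V) (i : σ →₀ ℕ), f = C a * map V.subtype F ∧
      coeff i F = 1 := by
  obtain ⟨i, hi, hmax⟩ := f.support.exists_max_image (fun i => V.valuation (coeff i f))
    (Finset.nonempty_iff_ne_empty.mpr (by simpa using hf))
  have ha : coeff i f ≠ 0 := by simpa using hi
  have hmem : C (coeff i f)⁻¹ * f ∈ (map V.subtype : MvPolynomial σ V →+* _).range := by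
    rw [RingHom.mem_range, ← Set.mem_range, mem_range_map_iff_coeffs_subset]
    intro x hx
    rw [Finset.mem_coe, mem_coeffs_iff] at hx
    obtain ⟨j, hj, rfl⟩ := hx
    rw [coeff_C_mul]
    have hle : V.valuation (coeff j f) ≤ V.valuation (coeff i f) := by
      by_cases h : j ∈ f.support
      · exact hmax j h
      · rw [notMem_support_iff.mp h]; simp
    obtain ⟨b, hb⟩ := (V.valuation_le_iff _ _).mp hle
    refine ⟨b, ?_⟩
    rw [← hb]
    change (b : K) = _
    field_simp
  obtain ⟨F, hF⟩ := hmem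
  refine ⟨coeff i f, F, i, ?_, ?_⟩
  · rw [hF, ← mul_assoc, ← C_mul, mul_inv_cancel₀ ha, C_1, one_mul]
  · apply V.subtype_injective
    rw [← coeff_map, hF, coeff_C_mul, inv_mul_cancel₀ ha, map_one]

open MvPolynomial in
theorem aux_kron_val {K σ : Type*} [Field K] (V : ValuationSubring K) (f g : MvPolynomial σ K)
    (h : ∀ m, coeff m (f * g) ∈ V) (i j : σ →₀ ℕ) : coeff i f * coeff j g ∈ V := by
  by_cases hf : f = 0
  · simp [hf, V.zero_mem]
  by_cases hg : g = 0
  · simp [hg, V.zero_mem]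
  obtain ⟨a, F, i0, rfl, hF⟩ := aux_normalize V f hf
  obtain ⟨b, G, j0, rfl, hG⟩ := aux_normalize V g hg
  have hF' : map (IsLocalRing.residue V) F ≠ 0 := by
    intro h0
    have := congrArg (coeff i0) h0
    rw [coeff_map, hF] at this
    simp at this
  have hG' : map (IsLocalRing.residue V) G ≠ 0 := by
    intro h0
    have := congrArg (coeff j0) h0
    rw [coeff_map, hG] at this
    simp at this
  obtain ⟨m, hm⟩ := ne_zero_iff.mp (mul_ne_zero hF' hG')
  rw [← map_mul, coeff_map, IsLocalRing.residue_ne_zero_iff_isUnit] at hm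
  obtain ⟨u, hu⟩ := hm
  have h1 := h m
  have e : C a * map V.subtype F * (C b * map V.subtype G) = C (a * b) * map V.subtype (F * G) := by
    rw [map_mul, map_mul]; ring
  rw [e, coeff_C_mul, coeff_map, ← hu] at h1
  have hab : a * b ∈ V := by
    have := V.mul_mem _ _ h1 (u⁻¹ : Vˣ).val.2
    have e2 : ((u : V) : K) * ((u⁻¹ : Vˣ) : V) = 1 := by
      have : (u : V) * (u⁻¹ : Vˣ) = 1 := by simp
      exact congrArg Subtype.val this
    rw [mul_assoc] at this
    erw [e2] at this
    simpa using this
  rw [coeff_C_mul, coeff_C_mul, coeff_map, coeff_map]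
  have e3 : a * V.subtype (coeff i F) * (b * V.subtype (coeff j G))
    = a * b * (V.subtype (coeff i F) * V.subtype (coeff j G)) := by ring
  rw [e3]
  exact V.mul_mem _ _ hab (V.mul_mem _ _ (coeff i F).2 (coeff j G).2)

open MvPolynomial in
theorem aux_kron {A K σ : Type*} [CommRing A] [IsDomain A] [IsIntegrallyClosed A] [Field K]
    [Algebra A K] [IsFractionRing A K] (f g : MvPolynomial σ K)
    (h : ∀ m, coeff m (f * g) ∈ (algebraMap A K).range) (i j : σ →₀ ℕ) :
    coeff i f * coeff j g ∈ (algebraMap A K).range := by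
  have hic : IsIntegrallyClosedIn (algebraMap A K).range K := by
    rw [isIntegrallyClosedIn_iff]
    refine ⟨Subtype.val_injective, fun {x} hx => ?_⟩
    have hx' : IsIntegral A x := by
      obtain ⟨P, hP, hx⟩ := hx
      have hl : P ∈ Polynomial.lifts ((algebraMap A K).rangeRestrict) := by
        rw [Polynomial.lifts_iff_coeff_lifts]
        intro n
        exact (algebraMap A K).rangeRestrict_surjective _
      obtain ⟨Q, hQ, -, hQm⟩ := Polynomial.lifts_and_degree_eq_and_monic hl hP
      refine ⟨Q, hQm, ?_⟩
      rw [← hQ, Polynomial.eval₂_map] at hx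
      exact hx
    obtain ⟨y, hy⟩ := (IsIntegrallyClosed.isIntegral_iff (R := A)).mp hx'
    exact ⟨⟨x, y, hy⟩, rfl⟩
  have := Subring.eq_iInf_of_isIntegrallyClosedIn (R := (algebraMap A K).range)
  rw [this, Subring.mem_iInf]
  rintro ⟨V, hV⟩
  exact aux_kron_val V f g (fun m => hV (h m)) i j
section
open TensorProduct


/-- The contraction to `K` of an `R`-submodule of `T`. -/
def auxContract (A K : Type) {R T : Type} [CommRing A] [Field K] [CommRing R] [CommRing T]
    [Algebra A K] [Algebra A R] [Algebra R T] [Algebra K T] [Algebra A T]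
    [IsScalarTower A R T] [IsScalarTower A K T] (J : Submodule R T) : Submodule A K :=
  (J.restrictScalars A).comap (IsScalarTower.toAlgHom A K T).toLinearMap

section
set_option linter.unusedSectionVars false
variable {A K R T : Type} [CommRing A] [Field K] [CommRing R] [CommRing T]
    [Algebra A K] [Algebra A R] [Algebra R T] [Algebra K T] [Algebra A T]
    [IsScalarTower A R T] [IsScalarTower A K T]

theorem aux_mem_contract (J : Submodule R T) (x : K) :
    x ∈ auxContract A K J ↔ algebraMap K T x ∈ J := Iff.rfl

theorem aux_span
    (H : ∀ t : T, t ∈ Submodule.span R (algebraMap K T '' {x | ∀ l, t * l ∈ (1 : Submodule R T) →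
      algebraMap K T x * l ∈ (1 : Submodule R T)}))
    (J : (Submodule R T)ˣ) (t : T) (ht : t ∈ (J : Submodule R T)) :
    t ∈ Submodule.span R (algebraMap K T '' (auxContract A K (J : Submodule R T) : Set K)) := by
  refine Submodule.span_mono (Set.image_mono ?_) (H t)
  intro x hx
  change algebraMap K T x ∈ (J : Submodule R T)
  have h1 : Submodule.span R {algebraMap K T x} * (J⁻¹ : (Submodule R T)ˣ) ≤ 1 := by
    rw [Submodule.mul_le]
    intro m hm l hl
    obtain ⟨r, rfl⟩ := Submodule.mem_span_singleton.mp hm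
    rw [smul_mul_assoc]
    refine Submodule.smul_mem _ _ (hx l ?_)
    rw [← J.mul_inv]
    exact Submodule.mul_mem_mul ht hl
  have h2 : Submodule.span R {algebraMap K T x} ≤ J := by
    calc _ = Submodule.span R {algebraMap K T x} * (J⁻¹ : (Submodule R T)ˣ) * J := by
            rw [mul_assoc, J.inv_mul, mul_one]
      _ ≤ 1 * J := mul_le_mul' h1 le_rfl
      _ = J := one_mul _
  exact h2 (Submodule.mem_span_singleton_self _)

theorem aux_retract (e : R →+* A) (eK : T →+* K)
    (heK : ∀ r, eK (algebraMap R T r) = algebraMap A K (e r))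
    (heK' : ∀ x : K, eK (algebraMap K T x) = x) 
    (I : Submodule A K) (t : T) (ht : t ∈ Submodule.span R (algebraMap K T '' I)) :
    eK t ∈ I := by
  induction ht using Submodule.span_induction with
  | mem x h => obtain ⟨y, hy, rfl⟩ := h; rwa [heK']
  | zero => simp
  | add x y _ _ hx hy => rw [map_add]; exact I.add_mem hx hy
  | smul r x _ hx => 
    rw [Algebra.smul_def, map_mul, heK, ← Algebra.smul_def]
    exact I.smul_mem _ hx

theorem aux_mul_eq_one (e : R →+* A) (eK : T →+* K)
    (heK : ∀ r, eK (algebraMap R T r) = algebraMap A K (e r))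
    (heK' : ∀ x : K, eK (algebraMap K T x) = x) 
    (H : ∀ t : T, t ∈ Submodule.span R (algebraMap K T '' {x | ∀ l, t * l ∈ (1 : Submodule R T) →
      algebraMap K T x * l ∈ (1 : Submodule R T)}))
    (J : (Submodule R T)ˣ) :
    auxContract A K (J : Submodule R T) * auxContract A K ((J⁻¹ : (Submodule R T)ˣ) : Submodule R T)
      = 1 := by
  apply le_antisymm
  · rw [Submodule.mul_le]
    intro x hx y hy
    have : algebraMap K T x * algebraMap K T y ∈ (1 : Submodule R T) := by
      rw [← J.mul_inv]; exact Submodule.mul_mem_mul hx hy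
    obtain ⟨r, hr⟩ := Submodule.mem_one.mp this
    rw [← map_mul] at hr
    have := congrArg eK hr
    rw [heK, heK'] at this
    exact Submodule.mem_one.mpr ⟨_, this⟩
  · rw [Submodule.one_le]
    have h1 : (1 : T) ∈ (J : Submodule R T) * (J⁻¹ : (Submodule R T)ˣ) := by
      rw [J.mul_inv]; exact Submodule.mem_one.mpr ⟨1, map_one _⟩
    rw [← map_one eK]
    generalize (1 : T) = t at h1
    induction h1 using Submodule.mul_induction_on' with
    | mem_mul_mem m hm n hn =>
      rw [map_mul]
      exact Submodule.mul_mem_mul (aux_retract e eK heK heK' _ _ (aux_span H J m hm))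
        (aux_retract e eK heK heK' _ _ (aux_span H J⁻¹ n hn))
    | add x _ y _ hx hy => rw [map_add]; exact Submodule.add_mem _ hx hy

theorem aux_surj_s12 [FaithfulSMul A K] [FaithfulSMul R T] [Subsingleton (CommRing.Pic T)]
    (e : R →+* A) (eK : T →+* K)
    (heK : ∀ r, eK (algebraMap R T r) = algebraMap A K (e r))
    (heK' : ∀ x : K, eK (algebraMap K T x) = x) 
    (H : ∀ t : T, t ∈ Submodule.span R (algebraMap K T '' {x | ∀ l, t * l ∈ (1 : Submodule R T) →
      algebraMap K T x * l ∈ (1 : Submodule R T)}))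
    (P : Type) [AddCommGroup P] [Module R P] [Module.Invertible R P] :
    ∃ (I : (Submodule A K)ˣ), Nonempty (P ≃ₗ[R] R ⊗[A] I) := by
  have hP : CommRing.Pic.mk R P ∈ CommRing.relPic R T := Subsingleton.elim _ _
  rw [← Submodule.range_unitsToPic] at hP
  obtain ⟨J, hJ⟩ := hP
  obtain ⟨f⟩ := CommRing.Pic.mk_eq_mk_iff.mp hJ
  let I : (Submodule A K)ˣ := ⟨auxContract A K (J : Submodule R T),
    auxContract A K ((J⁻¹ : (Submodule R T)ˣ) : Submodule R T),
    aux_mul_eq_one e eK heK heK' H J, by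
      rw [mul_comm]; exact aux_mul_eq_one e eK heK heK' H J⟩
  refine ⟨I, ?_⟩
  let φ : I →ₗ[A] (J : Submodule R T) :=
    { toFun := fun x => ⟨algebraMap K T x, x.2⟩
      map_add' := fun x y => Subtype.ext (by simp)
      map_smul' := fun a x => Subtype.ext (by
        change algebraMap K T (a • (x : K)) = a • algebraMap K T x
        rw [Algebra.smul_def, map_mul, ← IsScalarTower.algebraMap_apply, Algebra.smul_def]) }
  have : Module.Invertible A I := .left (Submodule.tensorInvEquiv I)
  have : Module.Invertible R (R ⊗[A] I) := inferInstance
  let ψ : R ⊗[A] I →ₗ[R] (J : Submodule R T) := φ.liftBaseChange R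
  have hψ : Function.Surjective ψ := by
    rintro ⟨t, ht⟩
    have h1 : Submodule.span R (algebraMap K T '' (auxContract A K (J : Submodule R T) : Set K))
        ≤ (LinearMap.range ψ).map (J : Submodule R T).subtype := by
      rw [Submodule.span_le]
      rintro _ ⟨x, hx, rfl⟩
      refine ⟨⟨_, hx⟩, ⟨1 ⊗ₜ ⟨x, hx⟩, ?_⟩, rfl⟩
      simp [ψ, φ]
    obtain ⟨y, ⟨z, hz⟩, hy⟩ := h1 (aux_span H J t ht)
    refine ⟨z, ?_⟩
    rw [hz]
    exact Subtype.ext hy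
  exact ⟨f.symm ≪≫ₗ (LinearEquiv.ofBijective ψ (Module.Invertible.bijective_of_surjective hψ)).symm⟩
end

theorem aux_inj_s12 {A R : Type} [CommRing A] [CommRing R] [Algebra A R] (e : R →ₐ[A] A)
    (M M' : Type) [AddCommGroup M] [Module A M] [AddCommGroup M'] [Module A M']
    (h : Nonempty ((R ⊗[A] M) ≃ₗ[R] (R ⊗[A] M'))) : Nonempty (M ≃ₗ[A] M') := by
  obtain ⟨f⟩ := h
  let _ : Algebra R A := e.toRingHom.toAlgebra
  have : IsScalarTower A R A := IsScalarTower.of_algebraMap_eq (fun a => (e.commutes a).symm)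
  let g (N : Type) [AddCommGroup N] [Module A N] : A ⊗[R] (R ⊗[A] N) ≃ₗ[A] N :=
    AlgebraTensorModule.cancelBaseChange A R A A N ≪≫ₗ TensorProduct.lid A N
  exact ⟨(g M).symm ≪≫ₗ AlgebraTensorModule.congr (.refl A A) f ≪≫ₗ g M'⟩

end

open MvPolynomial in
theorem aux_content {A K σ : Type*} [CommRing A] [IsDomain A] [IsIntegrallyClosed A] [Field K]
    [Algebra A K] [IsFractionRing A K] (q : MvPolynomial σ A) (v : σ → A) (hq : eval v q = 1)
    (f : MvPolynomial σ K)
    (h : ∀ m, coeff m (map (algebraMap A K) q * f) ∈ (algebraMap A K).range) (j : σ →₀ ℕ) :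
    coeff j f ∈ (algebraMap A K).range := by
  have key := fun i => aux_kron (map (algebraMap A K) q) f h i j
  have e : coeff j f = ∑ i ∈ q.support, algebraMap A K (∏ k ∈ i.support, v k ^ i k) *
      (coeff i (map (algebraMap A K) q) * coeff j f) := by
    have h1 := congrArg (algebraMap A K) hq
    rw [eval_eq, map_sum, map_one] at h1
    calc coeff j f = 1 * coeff j f := (one_mul _).symm
      _ = _ := by
        rw [← h1, Finset.sum_mul]
        refine Finset.sum_congr rfl fun i _ => ?_
        rw [map_mul, coeff_map]; ring
  rw [e]
  exact Subring.sum_mem _ fun i _ => Subring.mul_mem _ ⟨_, rfl⟩ (key i)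

section
open MvPolynomial TensorProduct

theorem aux_pic (T : Type) [CommRing T] [IsDomain T] [UniqueFactorizationMonoid T] :
    Subsingleton (CommRing.Pic T) := inferInstance

theorem aux_main {A σ : Type} [CommRing A] [IsDomain A] [IsIntegrallyClosed A]
    (d : MvPolynomial σ A) (v : σ → A) (hd : eval v d = 1) :
    (∀ (P : Type) [AddCommGroup P] [Module (Localization.Away d) P],
      Module.Invertible (Localization.Away d) P →
      ∃ (M : Type) (_ : AddCommGroup M) (_ : Module A M),
        Module.Invertible A M ∧
        Nonempty (P ≃ₗ[Localization.Away d] TensorProduct A (Localization.Away d) M)) ∧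
    (∀ (M M' : Type) [AddCommGroup M] [Module A M] [AddCommGroup M'] [Module A M'],
      Nonempty ((TensorProduct A (Localization.Away d) M)
        ≃ₗ[Localization.Away d] (TensorProduct A (Localization.Away d) M')) →
      Nonempty (M ≃ₗ[A] M')) := by
  have hu : ∀ y : Submonoid.powers d, IsUnit ((aeval v : MvPolynomial σ A →ₐ[A] A) y) := by
    rintro ⟨_, n, rfl⟩
    have : (aeval v : MvPolynomial σ A →ₐ[A] A) d = 1 := by rw [← hd]; simp
    rw [map_pow, this, one_pow]
    exact isUnit_one
  let e : Localization.Away d →ₐ[A] A :=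
    IsLocalization.liftAlgHom (M := Submonoid.powers d) (f := aeval v) hu
  refine ⟨?_, fun M M' _ _ _ _ h => aux_inj_s12 e M M' h⟩
  intro P _ _ hP
  let K := FractionRing A
  let ι : MvPolynomial σ A →+* MvPolynomial σ K := map (algebraMap A K)
  have hι : Function.Injective ι := map_injective _ (IsFractionRing.injective A K)
  let dK : MvPolynomial σ K := ι d
  have hd0 : d ≠ 0 := by rintro rfl; simp at hd
  have hdK0 : dK ≠ 0 := (map_ne_zero_iff ι hι).mpr hd0
  let R := Localization.Away d
  let T := Localization.Away dK
  have hle : Submonoid.powers dK ≤ nonZeroDivisors (MvPolynomial σ K) :=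
    powers_le_nonZeroDivisors_of_noZeroDivisors hdK0
  have hTinj : Function.Injective (algebraMap (MvPolynomial σ K) T) :=
    IsLocalization.injective T hle
  have : IsDomain T := IsLocalization.isDomain_of_le_nonZeroDivisors _ hle
  have : UniqueFactorizationMonoid T := inferInstance
  have : Subsingleton (CommRing.Pic T) := aux_pic T
  have hdu : IsUnit (algebraMap (MvPolynomial σ K) T dK) :=
    IsLocalization.Away.algebraMap_isUnit dK
  let φ : R →+* T := IsLocalization.Away.lift (S := R) d (g := (algebraMap (MvPolynomial σ K) T).comp ι) hdu
  have hφ : ∀ s, φ (algebraMap (MvPolynomial σ A) R s) = algebraMap _ T (ι s) := fun s =>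
    IsLocalization.Away.lift_eq d hdu s
  let _ : Algebra R T := φ.toAlgebra
  have : IsScalarTower A R T := IsScalarTower.of_algebraMap_eq (fun a => by
    change _ = φ _
    rw [IsScalarTower.algebraMap_apply A (MvPolynomial σ A) R, hφ,
      IsScalarTower.algebraMap_apply A (MvPolynomial σ K) T]
    simp [ι, MvPolynomial.algebraMap_eq, MvPolynomial.algebraMap_apply])
  have hRs : ∀ r : R, ∃ (n : ℕ) (s : MvPolynomial σ A),
      r * algebraMap _ R d ^ n = algebraMap _ R s := fun r => by
    obtain ⟨n, s, h⟩ := IsLocalization.Away.surj d r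
    exact ⟨n, s, h⟩
  have hTs : ∀ t : T, ∃ (n : ℕ) (s : MvPolynomial σ K),
      t * algebraMap _ T dK ^ n = algebraMap _ T s := fun r => by
    obtain ⟨n, s, h⟩ := IsLocalization.Away.surj dK r
    exact ⟨n, s, h⟩
  have hdR : IsUnit (algebraMap (MvPolynomial σ A) R d) :=
    IsLocalization.Away.algebraMap_isUnit d
  have hφi : Function.Injective φ := by
    rw [injective_iff_map_eq_zero]
    intro r hr
    obtain ⟨n, s, h⟩ := hRs r
    have h2 := congrArg φ h
    rw [map_mul, hr, zero_mul, hφ] at h2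
    have h3 : s = 0 := by
      apply hι; apply hTinj; rw [← h2]; simp
    rw [h3, map_zero] at h
    exact (hdR.pow n).mul_left_eq_zero.mp h
  have : FaithfulSMul R T := (faithfulSMul_iff_algebraMap_injective R T).mpr hφi
  let w : σ → K := fun i => algebraMap A K (v i)
  have hw : ∀ s, eval w (ι s) = algebraMap A K (eval v s) := fun s => by
    simp only [ι, w, eval_map]
    exact (eval₂_comp (algebraMap A K) v s).symm
  have hdw : IsUnit (eval w dK) := by
    change IsUnit (eval w (ι d))
    rw [hw, hd]; simp
  let eK : T →+* K := IsLocalization.Away.lift (S := T) dK (g := eval w) hdw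
  have heKs : ∀ s, eK (algebraMap (MvPolynomial σ K) T s) = eval w s := fun s =>
    IsLocalization.Away.lift_eq dK hdw s
  have hes : ∀ s, e (algebraMap (MvPolynomial σ A) R s) = eval v s := fun s => by
    change IsLocalization.lift _ _ = _
    rw [IsLocalization.lift_eq]
    simp [aeval_eq_eval]
  have heK : ∀ r, eK (algebraMap R T r) = algebraMap A K (e r) := by
    intro r
    have : (eK.comp φ) = (algebraMap A K).comp (e : R →+* A) := by
      apply IsLocalization.ringHom_ext (Submonoid.powers d)
      apply RingHom.ext
      intro s
      change eK (φ _) = algebraMap A K (e _)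
      rw [hφ, heKs, hw, hes]
    exact congrArg (fun f => f r) this
  have heK' : ∀ x : K, eK (algebraMap K T x) = x := by
    intro x
    rw [IsScalarTower.algebraMap_apply K (MvPolynomial σ K) T, heKs]
    simp [MvPolynomial.algebraMap_eq]
  have hone : ∀ t : T, t ∈ (1 : Submodule R T) ↔ ∃ r, φ r = t := fun t => Submodule.mem_one
  have H : ∀ t : T, t ∈ Submodule.span R (algebraMap K T '' {x | ∀ l, t * l ∈ (1 : Submodule R T) →
      algebraMap K T x * l ∈ (1 : Submodule R T)}) := by
    intro t
    obtain ⟨m, g, hg⟩ := hTs t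
    have key : ∀ l, t * l ∈ (1 : Submodule R T) → ∀ i,
        algebraMap K T (coeff i g) * l ∈ (1 : Submodule R T) := by
      intro l hl i
      obtain ⟨k, b, hb⟩ := hTs l
      obtain ⟨r, hr⟩ := (hone _).mp hl
      obtain ⟨j, s, hs⟩ := hRs r
      have h1 := congrArg φ hs
      rw [map_mul, map_pow, hφ, hφ, hr] at h1
      have h2 : ι (d ^ j) * (g * b) = ι (d ^ (m + k) * s) := by
        apply hTinj
        simp only [map_mul, map_pow, ← h1, ← hg, ← hb]
        change algebraMap _ T dK ^ j * _ = algebraMap _ T dK ^ (m + k) * (t * l * algebraMap _ T dK ^ j)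
        ring
      have h3 : ∀ n, coeff n (g * b) ∈ (algebraMap A K).range := by
        refine aux_content (d ^ j) v (by rw [map_pow, hd, one_pow]) (g * b) ?_
        intro n
        change coeff n (ι (d ^ j) * (g * b)) ∈ _
        rw [h2, coeff_map]
        exact ⟨_, rfl⟩
      have h4 := aux_kron g b h3 i
      have h5 : C (coeff i g) * b ∈ Set.range ι := by
        rw [mem_range_map_iff_coeffs_subset]
        intro x hx
        rw [Finset.mem_coe, mem_coeffs_iff] at hx
        obtain ⟨j, hj, rfl⟩ := hx
        rw [coeff_C_mul]
        exact h4 j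
      obtain ⟨z, hz⟩ := h5
      obtain ⟨u, hu⟩ := hdR.pow k
      rw [hone]
      refine ⟨algebraMap _ R z * ((u⁻¹ : Rˣ) : R), ?_⟩
      apply (hdu.pow k).mul_right_cancel
      have e1 : algebraMap _ T dK ^ k = φ (algebraMap _ R d ^ k) := by rw [map_pow, hφ]
      rw [mul_assoc _ l, hb]
      rw [e1, ← map_mul, ← hu, mul_assoc, Units.inv_mul, mul_one, hφ, hz, map_mul,
        IsScalarTower.algebraMap_apply K (MvPolynomial σ K) T]
      rfl
    obtain ⟨u, hu⟩ := hdR.pow m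
    have ht : t = ((u⁻¹ : Rˣ) : R) • algebraMap _ T g := by
      rw [← hg, Algebra.smul_def]
      change t = φ _ * _
      have e1 : algebraMap _ T dK ^ m = φ (algebraMap _ R d ^ m) := by rw [map_pow, hφ]
      rw [e1, ← hu, mul_left_comm, ← map_mul, Units.inv_mul, map_one, mul_one]
    rw [ht]
    apply Submodule.smul_mem
    rw [← ht]
    have e0 : algebraMap _ T g = _ := congrArg (algebraMap _ T) g.as_sum
    rw [e0, map_sum]
    refine Submodule.sum_mem _ fun i _ => ?_
    have e2 : algebraMap (MvPolynomial σ K) T (monomial i (coeff i g)) =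
        algebraMap _ R (monomial i (1 : A)) • algebraMap K T (coeff i g) := by
      rw [Algebra.smul_def]
      change _ = φ _ * _
      rw [hφ, IsScalarTower.algebraMap_apply K (MvPolynomial σ K) T, ← map_mul]
      congr 1
      simp only [ι, map_monomial, map_one, MvPolynomial.algebraMap_eq]
      rw [mul_comm, C_mul_monomial, mul_one]
    rw [e2]
    exact Submodule.smul_mem _ _ (Submodule.subset_span ⟨_, fun l hl => key l hl i, rfl⟩)
  obtain ⟨I, hI⟩ := aux_surj_s12 (A := A) (K := K) (R := R) (T := T) (e : R →+* A) eK heK heK' H P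
  exact ⟨(I : Submodule A K), inferInstance, inferInstance, inferInstance, hI⟩
end


/-- Let `A` be a Noetherian integrally closed (normal) domain and let
`R` be the coordinate ring of `(GL_n)^p` over `A`, i.e. the localization of the
polynomial ring in the `p · n²` variables `X^{(k)}_{ij}` at the product `det₁ ⋯ det_p`
of the block determinants.  Then `Pic(A) → Pic(R)` is an isomorphism: every invertible
`R`-module is extended from an invertible `A`-module, and two invertible `A`-modules
with isomorphic extensions are isomorphic. -/
theorem picardGroup_coordinate_ring_GL_pow_of_noetherian_normal
    (A : Type) [CommRing A] [IsDomain A] [IsNoetherianRing A] [IsIntegrallyClosed A]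
    (n p : ℕ) (hn : 1 ≤ n) (hp : 1 ≤ p)
    (d : Fin p → MvPolynomial (Fin p × Fin n × Fin n) A)
    (hd : ∀ k, d k = Matrix.det (Matrix.of fun i j : Fin n => MvPolynomial.X (k, i, j))) :
    (∀ (P : Type) [AddCommGroup P] [Module (Localization.Away (∏ k, d k)) P],
      IsInvertibleModule (Localization.Away (∏ k, d k)) P →
      ∃ (M : Type) (_ : AddCommGroup M) (_ : Module A M),
        IsInvertibleModule A M ∧
        Nonempty (P ≃ₗ[Localization.Away (∏ k, d k)]
          TensorProduct A (Localization.Away (∏ k, d k)) M)) ∧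
    (∀ (M M' : Type) [AddCommGroup M] [Module A M] [AddCommGroup M'] [Module A M'],
      IsInvertibleModule A M → IsInvertibleModule A M' →
      Nonempty ((TensorProduct A (Localization.Away (∏ k, d k)) M)
        ≃ₗ[Localization.Away (∏ k, d k)]
          (TensorProduct A (Localization.Away (∏ k, d k)) M')) →
      Nonempty (M ≃ₗ[A] M')) := by
  have hinv : ∀ (S M : Type) [CommRing S] [AddCommGroup M] [Module S M],
      IsInvertibleModule S M ↔ Module.Invertible S M := by
    intro S M _ _ _
    constructor
    · rintro ⟨N, _, _, ⟨f⟩⟩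
      exact Module.Invertible.left f
    · intro h
      exact ⟨Module.Dual S M, inferInstance, inferInstance,
        ⟨TensorProduct.comm S _ _ ≪≫ₗ Module.Invertible.linearEquiv S M⟩⟩
  have hev : MvPolynomial.eval (fun x : Fin p × Fin n × Fin n => if x.2.1 = x.2.2 then (1 : A) else 0)
      (∏ k, d k) = 1 := by
    rw [map_prod]
    refine Finset.prod_eq_one fun k _ => ?_
    rw [hd, RingHom.map_det]
    have : (RingHom.mapMatrix (MvPolynomial.eval
        (fun x : Fin p × Fin n × Fin n => if x.2.1 = x.2.2 then (1 : A) else 0)))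
        (Matrix.of fun i j : Fin n => MvPolynomial.X (k, i, j)) = (1 : Matrix (Fin n) (Fin n) A) := by
      ext i j
      simp [Matrix.one_apply]
    rw [this, Matrix.det_one]
  obtain ⟨h1, h2⟩ := aux_main (∏ k, d k) _ hev
  refine ⟨fun P _ _ hP => ?_, fun M M' _ _ _ _ _ _ h => h2 M M' h⟩
  obtain ⟨M, _, _, hM, h⟩ := h1 P ((hinv _ _).mp hP)
  exact ⟨M, _, _, (hinv _ _).mpr hM, h⟩
end
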